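/- arXiv:1910.11302 — 5 statements merged into one kernel-verified Lean document; each statement's English description precedes it below -/
import Mathlib

section
/- Let G be a finite connected simple graph on n vertices. If for every vertex v the maximum matching size satisfies ν(G − v) = ν(G), then 2·ν(G) = n − 1; equivalently, for every vertex v the graph G − v has a perfect matching (G is factor-critical). -/
/-- `ν(G)`: the maximum number of edges in a matching of `G`. -/
noncomputable def matchingNumber {W : Type*} (G : SimpleGraph W) : ℕ :=
  sSup {k : ℕ | ∃ M : G.Subgraph, M.IsMatching ∧ M.edgeSet.ncard = k}

namespace SimpleGraph

variable {V : Type*}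

theorem Subgraph.IsMatching.two_mul_ncard_edgeSet [Finite V] {G : SimpleGraph V}
    {M : G.Subgraph} (hM : M.IsMatching) : 2 * M.edgeSet.ncard = M.verts.ncard := by
  classical
  have := Fintype.ofFinite V
  have hsum := M.spanningCoe.sum_degrees_eq_twice_card_edges
  have hdeg (v : V) : M.spanningCoe.degree v = if v ∈ M.verts then 1 else 0 := by
    rw [Subgraph.degree_spanningCoe]
    split_ifs with hv
    · exact Subgraph.isMatching_iff_forall_degree.mp hM v hv
    · exact Subgraph.degree_of_notMem_verts hv
  have hedge : M.edgeSet.ncard = M.spanningCoe.edgeFinset.card := by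
    rw [← Set.ncard_coe_finset, coe_edgeFinset, Subgraph.edgeSet_spanningCoe]
  rw [hedge, ← hsum, Finset.sum_congr rfl fun v _ => hdeg v, Finset.sum_boole,
    ← Set.ncard_coe_finset]
  simp

theorem bddAbove_ncard_isMatching [Finite V] (G : SimpleGraph V) :
    BddAbove {k : ℕ | ∃ M : G.Subgraph, M.IsMatching ∧ M.edgeSet.ncard = k} := by
  refine ⟨Nat.card V, ?_⟩
  rintro k ⟨M, hM, rfl⟩
  have h := hM.two_mul_ncard_edgeSet
  have := Set.ncard_le_card M.verts
  omega

theorem Subgraph.IsMatching.ncard_edgeSet_le_matchingNumber [Finite V] {G : SimpleGraph V}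
    {M : G.Subgraph} (hM : M.IsMatching) : M.edgeSet.ncard ≤ matchingNumber G :=
  le_csSup G.bddAbove_ncard_isMatching ⟨M, hM, rfl⟩

theorem exists_isMatching_ncard_edgeSet_eq [Finite V] (G : SimpleGraph V) :
    ∃ M : G.Subgraph, M.IsMatching ∧ M.edgeSet.ncard = matchingNumber G :=
  Nat.sSup_mem (s := {k : ℕ | ∃ M : G.Subgraph, M.IsMatching ∧ M.edgeSet.ncard = k})
    ⟨0, ⊥, by simp [Subgraph.IsMatching], by simp⟩ G.bddAbove_ncard_isMatching

/-- An involution that moves vertices only along edges of `G`. These encode the matchings of `G`: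
a vertex is unmatched exactly when it is fixed. -/
structure IsMatchingInvolution (G : SimpleGraph V) (f : V → V) : Prop where
  involutive : Function.Involutive f
  adj_of_ne : ∀ v, f v ≠ v → G.Adj v (f v)

theorem Subgraph.IsMatching.exists_isMatchingInvolution {G : SimpleGraph V} {M : G.Subgraph}
    (hM : M.IsMatching) :
    ∃ f, G.IsMatchingInvolution f ∧ Function.fixedPoints f = M.vertsᶜ := by
  classical
  have hex (v : V) (hv : v ∈ M.verts) : ∃ w, M.Adj v w := (hM hv).exists
  choose! p hp using hex
  have hmem (v : V) (hv : v ∈ M.verts) : p v ∈ M.verts := (hp v hv).snd_mem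
  refine ⟨fun v => if v ∈ M.verts then p v else v, ⟨fun v => ?_, fun v hv => ?_⟩, ?_⟩
  · by_cases hv : v ∈ M.verts
    · simp only [hv, hmem v hv, if_true]
      exact hM.eq_of_adj_left (hp _ (hmem v hv)) (hp v hv).symm
    · simp [hv]
  · by_cases h : v ∈ M.verts
    · simpa [h] using (hp v h).adj_sub
    · simp [h] at hv
  · ext v
    by_cases h : v ∈ M.verts
    · simpa [Function.IsFixedPt, h] using (hp v h).adj_sub.ne'
    · simp [Function.IsFixedPt, h]

namespace IsMatchingInvolution

variable {G : SimpleGraph V} {f g : V → V}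

theorem exists_isMatching (hf : G.IsMatchingInvolution f) :
    ∃ M : G.Subgraph, M.IsMatching ∧ M.verts = (Function.fixedPoints f)ᶜ := by
  refine ⟨{ verts := (Function.fixedPoints f)ᶜ
            Adj := fun v w => f v = w ∧ v ≠ w
            adj_sub := ?_
            edge_vert := ?_
            symm := ?_ }, ?_, rfl⟩
  · rintro v w ⟨rfl, h⟩
    exact hf.adj_of_ne v h.symm
  · rintro v w ⟨rfl, h⟩
    exact h.symm
  · exact ⟨by
      rintro v w ⟨rfl, h⟩
      exact ⟨hf.involutive v, h.symm⟩⟩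
  · intro v hv
    exact ⟨f v, ⟨rfl, Ne.symm hv⟩, fun w hw => hw.1.symm⟩

theorem card_le [Finite V] (hf : G.IsMatchingInvolution f) :
    Nat.card V ≤ 2 * matchingNumber G + (Function.fixedPoints f).ncard := by
  obtain ⟨M, hM, hv⟩ := hf.exists_isMatching
  have h1 := hM.two_mul_ncard_edgeSet
  have h2 := hM.ncard_edgeSet_le_matchingNumber
  have h3 := Set.ncard_add_ncard_compl (Function.fixedPoints f)
  rw [hv] at h1
  omega

/-- Involutions that agree with `f` on a set stable under `f` and `g`, and with `g` off it. -/
theorem piecewise (hf : G.IsMatchingInvolution f) (hg : G.IsMatchingInvolution g) {S : Set V}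
    [∀ v, Decidable (v ∈ S)] (hfS : ∀ v ∈ S, f v ∈ S) (hgS : ∀ v ∈ S, g v ∈ S) :
    G.IsMatchingInvolution (S.piecewise f g) := by
  have hgS' (v : V) (hv : v ∉ S) : g v ∉ S := fun h => hv (hg.involutive v ▸ hgS _ h)
  refine ⟨fun v => ?_, fun v => ?_⟩
  · by_cases hv : v ∈ S
    · simp [hv, hfS, hf.involutive v]
    · simp [hv, hgS', hg.involutive v]
  · by_cases hv : v ∈ S
    · simpa [hv] using hf.adj_of_ne v
    · simpa [hv] using hg.adj_of_ne v

/-- An edge joining two unmatched vertices can be added to a matching. -/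
theorem exists_ncard_fixedPoints_lt [Finite V] (hf : G.IsMatchingInvolution f) {v w : V}
    (hvw : G.Adj v w) (hv : f v = v) (hw : f w = w) :
    ∃ g, G.IsMatchingInvolution g ∧
      (Function.fixedPoints g).ncard < (Function.fixedPoints f).ncard := by
  classical
  have hne := hvw.ne
  have hfv (x : V) : f x = v ↔ x = v := ⟨fun h => hf.involutive.injective (h.trans hv.symm),
    fun h => h ▸ hv⟩
  have hfw (x : V) : f x = w ↔ x = w := ⟨fun h => hf.involutive.injective (h.trans hw.symm),
    fun h => h ▸ hw⟩
  refine ⟨fun x => if x = v then w else if x = w then v else f x,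
    ⟨fun x => ?_, fun x => ?_⟩, Set.ncard_lt_ncard ⟨fun x hx => ?_, fun h => ?_⟩⟩
  · have := hf.involutive x
    grind
  · have := hf.adj_of_ne x
    have := hvw.symm
    grind
  · simp only [Function.mem_fixedPoints, Function.IsFixedPt] at hx ⊢
    grind
  · have := h (show v ∈ Function.fixedPoints f from hv)
    simp [Function.IsFixedPt, hne.symm] at this

end IsMatchingInvolution

theorem ncard_fixedPoints_piecewise_add [Finite V] (f g : V → V) (S : Set V)
    [∀ v, Decidable (v ∈ S)] :
    (Function.fixedPoints (S.piecewise f g)).ncard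
      + (Function.fixedPoints (S.piecewise g f)).ncard
      = (Function.fixedPoints f).ncard + (Function.fixedPoints g).ncard := by
  have key (f g : V → V) : (Function.fixedPoints (S.piecewise f g)).ncard
      = (Function.fixedPoints f ∩ S).ncard + (Function.fixedPoints g \ S).ncard := by
    rw [← Set.ncard_union_eq (Set.disjoint_sdiff_right.mono_left Set.inter_subset_right)]
    congr 1
    ext v
    by_cases hv : v ∈ S <;> simp [Function.IsFixedPt, hv]
  rw [key, key, ← Set.ncard_inter_add_ncard_sdiff_eq_ncard (Function.fixedPoints f) S,
    ← Set.ncard_inter_add_ncard_sdiff_eq_ncard (Function.fixedPoints g) S]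
  omega

/-- If `f` fixes `v`, then the orbit of `v` under the involutions `f` and `g` contains at most one
fixed point of `g`. -/
theorem _root_.Function.Involutive.exists_orbit {f g : V → V} (hf : f.Involutive)
    (hg : g.Involutive) {v : V} (hv : f v = v) :
    ∃ S : Set V, v ∈ S ∧ (∀ x ∈ S, f x ∈ S) ∧ (∀ x ∈ S, g x ∈ S) ∧
      (Function.fixedPoints g ∩ S).Subsingleton := by
  set r : Equiv.Perm V := hg.toPerm g * hf.toPerm f with hr
  have hinv : hf.toPerm f * r * (hf.toPerm f)⁻¹ = r⁻¹ := by
    ext x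
    change f (g (f (f x))) = f (g x)
    rw [hf x]
  have hfr (k : ℤ) : f ((r ^ k) v) = (r ^ (-k)) v := by
    have h : hf.toPerm f * r ^ k * (hf.toPerm f)⁻¹ = r ^ (-k) := by
      rw [← conj_zpow, hinv, inv_zpow, zpow_neg]
    have h' : (hf.toPerm f)⁻¹ v = v := by
      rw [Equiv.Perm.inv_eq_iff_eq]; exact hv.symm
    rw [← h, Equiv.Perm.mul_apply, Equiv.Perm.mul_apply, h']
    rfl
  have hgr (k : ℤ) : g ((r ^ k) v) = (r ^ (1 - k)) v := by
    rw [sub_eq_add_neg, zpow_add, zpow_one, Equiv.Perm.mul_apply, ← hfr, hr,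
      Equiv.Perm.mul_apply]
    simp [hf _]
  refine ⟨Set.range fun k : ℤ => (r ^ k) v, ⟨0, by simp⟩, ?_, ?_, ?_⟩
  · rintro _ ⟨k, rfl⟩
    exact ⟨-k, (hfr k).symm⟩
  · rintro _ ⟨k, rfl⟩
    exact ⟨1 - k, (hgr k).symm⟩
  · rintro _ ⟨ha, a, rfl⟩ _ ⟨hb, b, rfl⟩
    let H := MulAction.stabilizer (Equiv.Perm V) v
    have hiff (a b : ℤ) : (r ^ a) v = (r ^ b) v ↔ r ^ (a - b) ∈ H := by
      rw [MulAction.mem_stabilizer_iff, Equiv.Perm.smul_def, sub_eq_neg_add, zpow_add,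
        Equiv.Perm.mul_apply, zpow_neg, Equiv.Perm.inv_eq_iff_eq]
    have h1 : r ^ (1 - a - a) ∈ H := (hiff _ _).mp ((hgr a).symm.trans ha)
    have h2 : r ^ (1 - b - b) ∈ H := (hiff _ _).mp ((hgr b).symm.trans hb)
    refine (hiff a b).mpr ?_
    have h3 := H.mul_mem (H.zpow_mem h1 (-b)) (H.zpow_mem h2 a)
    rw [← zpow_mul, ← zpow_mul, ← zpow_add] at h3
    convert h3 using 2
    ring

/-- If every vertex is missed by a maximum matching of a connected graph, then no maximum matching
misses two vertices. -/
theorem Connected.fixedPoints_subsingleton [Finite V] {G : SimpleGraph V} (hG : G.Connected) {d : ℕ}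
    (hmin : ∀ f, G.IsMatchingInvolution f → d ≤ (Function.fixedPoints f).ncard)
    (hex : ∀ v, ∃ f, G.IsMatchingInvolution f ∧ (Function.fixedPoints f).ncard = d ∧ f v = v)
    {f : V → V} (hf : G.IsMatchingInvolution f) (hfd : (Function.fixedPoints f).ncard = d) :
    (Function.fixedPoints f).Subsingleton := by
  classical
  have key (u w : V) (huw : G.Reachable u w) : ∀ g, G.IsMatchingInvolution g →
      (Function.fixedPoints g).ncard = d → g u = u → g w = w → u = w := by
    rw [reachable_iff_reflTransGen] at huw
    induction huw with
    | refl => exact fun _ _ _ _ _ => rfl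
    | @tail v w _ hvw ih =>
      intro g hg hgd hu hw
      by_contra hne
      have hgv : g v ≠ v := by
        intro hgv
        obtain ⟨g', hg', hlt⟩ := hg.exists_ncard_fixedPoints_lt hvw hgv hw
        have := hmin g' hg'
        omega
      obtain ⟨f, hf, hfd, hfv⟩ := hex v
      obtain ⟨S, hvS, hfS, hgS, hS⟩ := hf.involutive.exists_orbit hg.involutive hfv
      have hsum := ncard_fixedPoints_piecewise_add f g S
      have hfg := hf.piecewise hg hfS hgS
      have h1 := hmin _ hfg
      have h2 := hmin _ (hg.piecewise hf hgS hfS)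
      have hd : (Function.fixedPoints (S.piecewise f g)).ncard = d := by omega
      have hv : S.piecewise f g v = v := by simp [hvS, hfv]
      by_cases huS : u ∈ S
      · have hwS : w ∉ S := fun hwS => hne (hS ⟨hu, huS⟩ ⟨hw, hwS⟩)
        obtain ⟨g', hg', hlt⟩ := hfg.exists_ncard_fixedPoints_lt hvw hv (by simp [hwS, hw])
        have := hmin g' hg'
        omega
      · obtain rfl := ih _ hfg hd (by simp [huS, hu]) hv
        exact hgv hu
  exact fun u hu w hw => key u w (hG u w) f hf hfd hu hw

end SimpleGraph

open SimpleGraph in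
/-- **Gallai's lemma**: if `G` is a finite connected graph such that deleting
any vertex does not decrease the matching number, then `2ν(G) = n - 1`;
equivalently, deleting any vertex leaves a graph with a perfect matching
(`G` is factor-critical). -/
theorem stmt_0 {V : Type*} [Fintype V] (G : SimpleGraph V)
    (hConn : G.Connected)
    (hν : ∀ v : V, matchingNumber (G.induce ({v}ᶜ : Set V)) = matchingNumber G) :
    2 * matchingNumber G = Fintype.card V - 1 ∧
    ∀ v : V, ∃ M : (G.induce ({v}ᶜ : Set V)).Subgraph, M.IsPerfectMatching := by
  have hmatch (v : V) : ∃ f, G.IsMatchingInvolution f ∧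
      (Function.fixedPoints f).ncard = Fintype.card V - 2 * matchingNumber G ∧ f v = v := by
    obtain ⟨M, hM, hMν⟩ := (G.induce ({v}ᶜ : Set V)).exists_isMatching_ncard_edgeSet_eq
    have hM' := hM.map (Embedding.induce ({v}ᶜ : Set V)).toHom Subtype.val_injective
    obtain ⟨f, hf, hfix⟩ := hM'.exists_isMatchingInvolution
    refine ⟨f, hf, ?_, ?_⟩
    · have h1 := hM.two_mul_ncard_edgeSet
      rw [hMν, hν] at h1
      rw [hfix, Set.ncard_compl, h1, Subgraph.map_verts, Nat.card_eq_fintype_card]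
      congr 1
      exact Set.ncard_image_of_injective _ Subtype.val_injective
    · change v ∈ Function.fixedPoints f
      rw [hfix]
      simp
  have hmin (f : V → V) (hf : G.IsMatchingInvolution f) :
      Fintype.card V - 2 * matchingNumber G ≤ (Function.fixedPoints f).ncard := by
    have := hf.card_le
    rw [Nat.card_eq_fintype_card] at this
    omega
  obtain ⟨v₀⟩ := hConn.nonempty
  have hone : Fintype.card V - 2 * matchingNumber G = 1 := by
    obtain ⟨f, hf, hfd, hfv⟩ := hmatch v₀
    rw [← hfd, Set.ncard_eq_one]
    exact ⟨v₀, (hConn.fixedPoints_subsingleton hmin hmatch hf hfd).eq_singleton_of_mem hfv⟩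
  refine ⟨by omega, fun v => ?_⟩
  obtain ⟨M, hM, hMν⟩ := (G.induce ({v}ᶜ : Set V)).exists_isMatching_ncard_edgeSet_eq
  refine ⟨M, hM, Subgraph.isSpanning_iff.mpr ?_⟩
  have h1 := hM.two_mul_ncard_edgeSet
  rw [hMν, hν] at h1
  refine M.verts.eq_univ_iff_ncard.mpr ?_
  have h2 := Set.ncard_compl ({v} : Set V)
  rw [Set.ncard_singleton, Nat.card_eq_fintype_card] at h2
  rw [Nat.card_coe_set_eq]
  omega
end

section
/- Let G be a finite simple graph on n vertices whose complement is connected, and suppose that χ(G − v) = χ(G) − 1 for every vertex v (G is color-critical). Then 2·χ(G) ≤ n + 1. -/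
namespace SimpleGraph

open Finset

/-- **Hall's marriage theorem** for the elements of a finset. -/
lemma exists_injOn_of_card_le_card_biUnion {α β : Type*} [DecidableEq β] [Nonempty β]
    {X : Finset α} {t : α → Finset β} (h : ∀ C ⊆ X, #C ≤ #(C.biUnion t)) :
    ∃ f : α → β, Set.InjOn f X ∧ ∀ x ∈ X, f x ∈ t x := by
  classical
  obtain ⟨g, hg, hgt⟩ := (all_card_le_biUnion_card_iff_exists_injective
    fun x : X ↦ t x).1 fun s ↦ by
      have := h (s.map (Function.Embedding.subtype _)) (map_subtype_subset s)
      simpa [Finset.map_eq_image, image_biUnion, card_image_of_injective] using this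
  refine ⟨fun x ↦ if hx : x ∈ X then g ⟨x, hx⟩ else Classical.arbitrary β, ?_, ?_⟩
  · intro x hx y hy hxy
    simp only [mem_coe] at hx hy
    simp only [hx, hy, dif_pos] at hxy
    exact congrArg Subtype.val (hg hxy)
  · intro x hx
    simpa [hx] using hgt ⟨x, hx⟩

variable {V : Type*} (G : SimpleGraph V)

/-- `f` is a proper coloring of the subgraph of `G` induced by `W`. -/
def IsProperOn (W : Finset V) (f : V → ℕ) : Prop :=
  ∀ x ∈ W, ∀ y ∈ W, G.Adj x y → f x ≠ f y

/-- The chromatic number of the subgraph of `G` induced by `W`. -/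
noncomputable def chromOn (W : Finset V) : ℕ :=
  sInf {m | ∃ f : V → ℕ, G.IsProperOn W f ∧ #(W.image f) = m}

/-- Every vertex of `S` is adjacent to every vertex of `T`. -/
def IsJoined (S T : Finset V) : Prop :=
  ∀ x ∈ S, ∀ y ∈ T, G.Adj x y

/-- The complement of the subgraph induced by `W` cannot be split into two parts with no edge
between them. -/
def IsCoconnectedOn [DecidableEq V] (W : Finset V) : Prop :=
  ∀ S ⊆ W, S.Nonempty → S ≠ W → ∃ x ∈ S, ∃ y ∈ W \ S, ¬ G.Adj x y

/-- Deleting any vertex of `W` decreases the chromatic number of the subgraph induced by `W`. -/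
def IsCriticalOn [DecidableEq V] (W : Finset V) : Prop :=
  ∀ v ∈ W, G.chromOn (W.erase v) < G.chromOn W

variable {G} {S T W X : Finset V} {P : Finset (Finset V)}

lemma chromOn_le {f : V → ℕ} (hf : G.IsProperOn W f) : G.chromOn W ≤ #(W.image f) :=
  Nat.sInf_le ⟨f, hf, rfl⟩

lemma IsJoined.symm (h : G.IsJoined S T) : G.IsJoined T S :=
  fun x hx y hy ↦ (h y hy x hx).symm

lemma IsJoined.disjoint (h : G.IsJoined S T) : Disjoint S T :=
  Finset.disjoint_left.2 fun x hx hx' ↦ (h x hx x hx').ne rfl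

@[simp] lemma chromOn_empty : G.chromOn ∅ = 0 := by
  simpa using chromOn_le (G := G) (W := ∅) (f := fun _ ↦ 0) (by simp [IsProperOn])

lemma chromOn_pair_le_one [DecidableEq V] {x y : V} (h : ¬ G.Adj x y) : G.chromOn {x, y} ≤ 1 := by
  refine (chromOn_le (f := fun _ ↦ 0) ?_).trans ?_
  · intro a ha b hb hab
    simp only [mem_insert, mem_singleton] at ha hb
    rcases ha with rfl | rfl <;> rcases hb with rfl | rfl <;> simp_all [G.adj_comm]
  · exact (card_le_card (t := {0}) (by simp)).trans (by simp)

variable [Fintype V]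

variable (G) in
lemma exists_isProperOn_card_eq_chromOn (W : Finset V) :
    ∃ f : V → ℕ, G.IsProperOn W f ∧ #(W.image f) = G.chromOn W := by
  refine Nat.sInf_mem (s := {m | ∃ f : V → ℕ, G.IsProperOn W f ∧ #(W.image f) = m})
    ⟨_, fun v ↦ Fintype.equivFin V v, fun x _ y _ hxy h ↦ hxy.ne ?_, rfl⟩
  exact (Fintype.equivFin V).injective (Fin.val_injective h)

lemma chromOn_mono (h : S ⊆ T) : G.chromOn S ≤ G.chromOn T := by
  obtain ⟨f, hf, hc⟩ := G.exists_isProperOn_card_eq_chromOn T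
  exact (chromOn_le fun x hx y hy ↦ hf x (h hx) y (h hy)).trans
    ((card_le_card (image_subset_image h)).trans hc.le)

variable [DecidableEq V]

variable (G) in
lemma chromOn_union_le (S T : Finset V) : G.chromOn (S ∪ T) ≤ G.chromOn S + G.chromOn T := by
  obtain ⟨f, hf, hfc⟩ := G.exists_isProperOn_card_eq_chromOn S
  obtain ⟨g, hg, hgc⟩ := G.exists_isProperOn_card_eq_chromOn T
  let h : V → ℕ := fun x ↦ if x ∈ S then 2 * f x else 2 * g x + 1
  have hh : G.IsProperOn (S ∪ T) h := by
    intro x hx y hy hxy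
    simp only [mem_union] at hx hy
    by_cases hxS : x ∈ S <;> by_cases hyS : y ∈ S <;> simp only [h, hxS, hyS, if_true, if_false]
    · have := hf x hxS y hyS hxy; omega
    · omega
    · omega
    · have := hg x (by tauto) y (by tauto) hxy; omega
  have hsub : (S ∪ T).image h ⊆
      (S.image f).image (fun n ↦ 2 * n) ∪ (T.image g).image (fun n ↦ 2 * n + 1) := by
    intro c hc
    obtain ⟨x, hx, rfl⟩ := mem_image.1 hc
    by_cases hxS : x ∈ S
    · exact mem_union_left _ (by
        simp only [h, hxS, if_true]; exact mem_image_of_mem _ (mem_image_of_mem _ hxS))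
    · have hxT : x ∈ T := (mem_union.1 hx).resolve_left hxS
      exact mem_union_right _ (by
        simp only [h, hxS, if_false]
        exact mem_image_of_mem (fun n ↦ 2 * n + 1) (mem_image_of_mem _ hxT))
  calc G.chromOn (S ∪ T) ≤ _ := chromOn_le hh
    _ ≤ _ := card_le_card hsub
    _ ≤ _ := card_union_le _ _
    _ ≤ #(S.image f) + #(T.image g) := add_le_add card_image_le card_image_le
    _ = _ := by rw [hfc, hgc]

lemma IsJoined.chromOn_union (h : G.IsJoined S T) :
    G.chromOn (S ∪ T) = G.chromOn S + G.chromOn T := by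
  refine (G.chromOn_union_le S T).antisymm ?_
  obtain ⟨f, hf, hfc⟩ := G.exists_isProperOn_card_eq_chromOn (S ∪ T)
  rw [← hfc, image_union, card_union_of_disjoint (Finset.disjoint_left.2 ?_)]
  · exact add_le_add
      (chromOn_le fun x hx y hy ↦ hf x (mem_union_left _ hx) y (mem_union_left _ hy))
      (chromOn_le fun x hx y hy ↦ hf x (mem_union_right _ hx) y (mem_union_right _ hy))
  · intro c hc hc'
    obtain ⟨x, hx, rfl⟩ := mem_image.1 hc
    obtain ⟨y, hy, hxy⟩ := mem_image.1 hc'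
    exact hf x (mem_union_left _ hx) y (mem_union_right _ hy) (h x hx y hy) hxy.symm

variable (G) in
lemma chromOn_biUnion_le (P : Finset (Finset V)) (F : Finset V → Finset V) :
    G.chromOn (P.biUnion F) ≤ ∑ D ∈ P, G.chromOn (F D) := by
  induction P using Finset.induction_on with
  | empty => simp
  | insert D P hD ih =>
    rw [biUnion_insert, sum_insert hD]
    exact (G.chromOn_union_le _ _).trans (by omega)

lemma sum_chromOn_le (h : (P : Set (Finset V)).Pairwise G.IsJoined) :
    ∑ D ∈ P, G.chromOn D ≤ G.chromOn (P.biUnion id) := by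
  induction P using Finset.induction_on with
  | empty => simp
  | insert D P hD ih =>
    rw [coe_insert] at h
    have hj : G.IsJoined D (P.biUnion id) := by
      intro x hx y hy
      obtain ⟨E, hE, hyE⟩ := mem_biUnion.1 hy
      exact h (Set.mem_insert _ _) (Set.mem_insert_of_mem _ hE)
        (fun h' ↦ hD (h' ▸ hE)) x hx y hyE
    rw [biUnion_insert, sum_insert hD, id, hj.chromOn_union]
    exact Nat.add_le_add_left (ih (h.mono (Set.subset_insert _ _))) _

lemma IsCriticalOn.chromOn_insert_le (h : G.IsCriticalOn W) {x y : V} (hy : y ∈ W)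
    (hxy : ¬ G.Adj x y) : G.chromOn (insert x W) ≤ G.chromOn W := by
  have hsub : insert x W ⊆ W.erase y ∪ {x, y} := by
    intro z hz
    simp only [mem_insert, mem_union, mem_erase, mem_singleton] at hz ⊢
    tauto
  have := (chromOn_mono hsub).trans (G.chromOn_union_le _ _)
  have := chromOn_pair_le_one hxy
  have := h y hy
  omega

lemma IsCriticalOn.left_of_isJoined (h : G.IsCriticalOn (S ∪ T)) (hj : G.IsJoined S T) :
    G.IsCriticalOn S := by
  intro v hv
  have hlt := h v (mem_union_left _ hv)
  have hv' : v ∉ T := Finset.disjoint_left.1 hj.disjoint hv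
  have hj' : G.IsJoined (S.erase v) T := fun x hx ↦ hj x (mem_of_mem_erase hx)
  rw [erase_union_distrib, erase_eq_of_notMem hv', hj'.chromOn_union, hj.chromOn_union] at hlt
  omega

/-- A critical set is a join of critical coconnected sets. -/
lemma IsCriticalOn.exists_join_decomposition (h : G.IsCriticalOn W) :
    ∃ P : Finset (Finset V), P.biUnion id = W ∧ (P : Set (Finset V)).Pairwise G.IsJoined ∧
      ∀ D ∈ P, D.Nonempty ∧ G.IsCriticalOn D ∧ G.IsCoconnectedOn D := by
  induction W using Finset.strongInduction with
  | H W ih =>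
  rcases W.eq_empty_or_nonempty with rfl | hne
  · exact ⟨∅, by simp⟩
  by_cases hc : G.IsCoconnectedOn W
  · exact ⟨{W}, by simp, by simp, by simp [hne, h, hc]⟩
  simp only [IsCoconnectedOn, not_forall, not_exists, not_and, not_not] at hc
  obtain ⟨S, hSW, hS, hSne, hj⟩ := hc
  have hj : G.IsJoined S (W \ S) := hj
  have hU : S ∪ W \ S = W := union_sdiff_of_subset hSW
  have hS' : S ⊂ W := hSW.ssubset_of_ne hSne
  obtain ⟨P, hP, hPj, hPc⟩ := ih S hS' ((hU.symm ▸ h).left_of_isJoined hj)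
  obtain ⟨Q, hQ, hQj, hQc⟩ := ih (W \ S) (sdiff_ssubset hSW hS)
    (IsCriticalOn.left_of_isJoined (T := S) (by rwa [union_comm, hU]) hj.symm)
  have hPQ : ∀ D ∈ P, ∀ E ∈ Q, G.IsJoined D E := fun D hD E hE x hx y hy ↦
    hj x (hP ▸ mem_biUnion.2 ⟨D, hD, hx⟩) y (hQ ▸ mem_biUnion.2 ⟨E, hE, hy⟩)
  refine ⟨P ∪ Q, by rw [union_biUnion, hP, hQ, hU], ?_, ?_⟩
  · intro D hD E hE hne
    rcases mem_union.1 hD with hD | hD <;> rcases mem_union.1 hE with hE | hE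
    · exact hPj hD hE hne
    · exact hPQ D hD E hE
    · exact (hPQ E hE D hD).symm
    · exact hQj hD hE hne
  · intro D hD
    exact (mem_union.1 hD).elim (hPc D) (hQc D)

/-- Vertices that can be matched into distinct critical sets, each with a non-neighbor in its
partner, do not need extra colors. -/
lemma chromOn_union_biUnion_le (hP : ∀ D ∈ P, G.IsCriticalOn D) {f : V → Finset V}
    (hinj : Set.InjOn f X) (hfP : ∀ x ∈ X, f x ∈ P)
    (hf : ∀ x ∈ X, ∃ y ∈ f x, ¬ G.Adj x y) :
    G.chromOn (X ∪ P.biUnion id) ≤ ∑ D ∈ P, G.chromOn D := by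
  have hsub : X ∪ P.biUnion id ⊆ P.biUnion fun D ↦ {x ∈ X | f x = D} ∪ D := by
    intro x hx
    simp only [mem_union, mem_biUnion, id, mem_filter] at hx ⊢
    rcases hx with hx | ⟨D, hD, hx⟩
    · exact ⟨f x, hfP x hx, .inl ⟨hx, rfl⟩⟩
    · exact ⟨D, hD, .inr hx⟩
  refine (chromOn_mono hsub).trans ((G.chromOn_biUnion_le _ _).trans (sum_le_sum fun D hD ↦ ?_))
  by_cases hx : ∃ x ∈ X, f x = D
  · obtain ⟨x, hx, rfl⟩ := hx
    obtain ⟨y, hy, hxy⟩ := hf x hx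
    refine (chromOn_mono ?_).trans ((hP _ hD).chromOn_insert_le hy hxy)
    intro z hz
    simp only [mem_union, mem_filter, mem_insert] at hz ⊢
    exact hz.imp_left fun h ↦ hinj h.1 hx h.2
  · rw [filter_eq_empty_iff.2 fun x hxX h ↦ hx ⟨x, hxX, h⟩, empty_union]

/-- **Gallai's theorem**, for induced subgraphs. -/
theorem IsCriticalOn.two_mul_chromOn_le (hcrit : G.IsCriticalOn W) (hne : W.Nonempty)
    (hconn : G.IsCoconnectedOn W) : 2 * G.chromOn W ≤ #W + 1 := by
  classical
  induction W using Finset.strongInduction with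
  | H V₀ ih =>
  by_contra! hlt
  -- a minimal subset of chromatic number at least `χ - 1` is a join of smaller critical sets
  obtain ⟨W, hWV, hW⟩ := exists_minimal_le_of_wellFoundedLT
    (fun S : Finset V ↦ G.chromOn V₀ ≤ G.chromOn S + 1) V₀ (by omega)
  have hWlt : ∀ v ∈ W, G.chromOn (W.erase v) + 1 < G.chromOn V₀ := by
    intro v hv
    by_contra! h
    exact notMem_erase v W (hW.le_of_le h (erase_subset _ _) hv)
  have hWcrit : G.IsCriticalOn W := fun v hv ↦ by
    have := hWlt v hv
    have := hW.prop
    omega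
  have hWne : W ≠ V₀ := by
    rintro rfl
    obtain ⟨v, hv⟩ := hne
    have h1 := G.chromOn_union_le (W.erase v) {v}
    have h2 := chromOn_pair_le_one (G.loopless.irrefl v)
    rw [pair_eq_singleton] at h2
    rw [union_comm, ← insert_eq, insert_erase hv] at h1
    have := hWlt v hv
    omega
  obtain ⟨P, hPW, hPj, hPc⟩ := hWcrit.exists_join_decomposition
  have hPsub : ∀ D ∈ P, D ⊆ W := fun D hD ↦ hPW ▸ subset_biUnion_of_mem id hD
  set A := V₀ \ W with hA
  have hAne : A ≠ ∅ := fun h ↦ hWne (hWV.antisymm (sdiff_eq_empty_iff_subset.1 h))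
  have hcard : #A ≤ #P := by
    have h1 : G.chromOn W ≤ ∑ D ∈ P, G.chromOn D := hPW ▸ G.chromOn_biUnion_le P id
    have h2 : ∑ D ∈ P, 2 * G.chromOn D ≤ ∑ D ∈ P, (#D + 1) := sum_le_sum fun D hD ↦
      ih D ((hPsub D hD).trans_ssubset (hWV.ssubset_of_ne hWne)) (hPc D hD).2.1 (hPc D hD).1
        (hPc D hD).2.2
    have h3 : #W = ∑ D ∈ P, #D := by
      rw [← hPW]
      exact card_biUnion fun D hD E hE hDE ↦ (hPj hD hE hDE).disjoint
    rw [← mul_sum, sum_add_distrib, ← h3, sum_const, smul_eq_mul, mul_one] at h2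
    have h4 := card_sdiff_add_card_eq_card hWV
    have h5 : G.chromOn V₀ ≤ G.chromOn W + 1 := hW.prop
    rw [← hA] at h4
    omega
  -- the parts of the join that are not completely joined to a vertex
  let N : V → Finset (Finset V) := fun x ↦ {D ∈ P | ∃ y ∈ D, ¬ G.Adj x y}
  have key : ∀ B ⊆ A, (∀ C ⊆ A, #C + #(B.biUnion N) ≤ #B + #(C.biUnion N)) → B = A := by
    intro B hBA hB
    by_contra hne'
    obtain ⟨x, hx⟩ := sdiff_nonempty.2 fun h ↦ hne' (hBA.antisymm h)
    obtain ⟨f, hinj, hf⟩ := exists_injOn_of_card_le_card_biUnion (X := A \ B)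
      (t := fun x ↦ N x \ B.biUnion N) (by
        intro C hC
        have h1 := hB (B ∪ C) (union_subset hBA (hC.trans sdiff_subset))
        have h2 : C.biUnion (fun x ↦ N x \ B.biUnion N) = C.biUnion N \ B.biUnion N := by
          ext; simp only [mem_biUnion, mem_sdiff]; tauto
        rw [card_union_of_disjoint (disjoint_sdiff.mono_right hC), union_biUnion,
          union_comm (B.biUnion N), ← card_sdiff_add_card] at h1
        rw [h2]
        omega)
    have hfN : ∀ x ∈ A \ B, f x ∈ P \ B.biUnion N ∧ ∃ y ∈ f x, ¬ G.Adj x y := by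
      intro x hx
      have := hf x hx
      simp only [N, mem_sdiff, mem_filter] at this ⊢
      tauto
    set Z := P \ B.biUnion N with hZ
    have hNP : B.biUnion N ⊆ P := biUnion_subset.2 fun x _ ↦ filter_subset _ _
    have hj : G.IsJoined (B ∪ (B.biUnion N).biUnion id) (Z.biUnion id) := by
      intro r hr y hy
      obtain ⟨D, hD, hyD⟩ := mem_biUnion.1 hy
      obtain ⟨hDP, hDB⟩ := mem_sdiff.1 hD
      rcases mem_union.1 hr with hr | hr
      · by_contra h
        exact hDB (mem_biUnion.2 ⟨r, hr, mem_filter.2 ⟨hDP, y, hyD, h⟩⟩)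
      · obtain ⟨E, hE, hrE⟩ := mem_biUnion.1 hr
        exact hPj (hNP hE) hDP (by rintro rfl; exact hDB hE) r hrE y hyD
    have hZP : ∀ v, v ∈ W ↔ v ∈ Z.biUnion id ∨ v ∈ (B.biUnion N).biUnion id := fun v ↦ by
      rw [← mem_union, ← union_biUnion, hZ, sdiff_union_of_subset hNP, hPW]
    have hcover : V₀ ⊆ (B ∪ (B.biUnion N).biUnion id) ∪ ((A \ B) ∪ Z.biUnion id) := by
      intro v hv
      have := hZP v
      simp only [mem_union, mem_sdiff, hA]
      tauto
    have hsub : (B ∪ (B.biUnion N).biUnion id) ∪ Z.biUnion id ⊆ V₀.erase x := by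
      intro v hv
      have := hZP v
      rw [mem_sdiff, hA, mem_sdiff] at hx
      have hv' : v ∈ B ∨ v ∈ W := by
        simp only [mem_union] at hv
        tauto
      rcases hv' with hv' | hv'
      · exact mem_erase.2 ⟨fun h ↦ hx.2 (h ▸ hv'), (mem_sdiff.1 (hBA hv')).1⟩
      · exact mem_erase.2 ⟨fun h ↦ hx.1.2 (h ▸ hv'), hWV hv'⟩
    have h1 := (chromOn_mono hcover).trans (G.chromOn_union_le _ _)
    have h2 := chromOn_union_biUnion_le (P := Z)
      (fun D hD ↦ (hPc D (mem_sdiff.1 hD).1).2.1) hinj (fun x hx ↦ (hfN x hx).1)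
      fun x hx ↦ (hfN x hx).2
    have h3 := sum_chromOn_le (P := Z) (hPj.mono fun D hD ↦ (mem_sdiff.1 hD).1)
    have h4 := chromOn_mono (G := G) hsub
    rw [hj.chromOn_union] at h4
    have h5 := hcrit x (mem_sdiff.1 (mem_sdiff.1 hx).1).1
    omega
  obtain ⟨B, hB, hmax⟩ := exists_max_image A.powerset
    (fun B ↦ (#B : ℤ) - #(B.biUnion N)) ⟨∅, by simp⟩
  replace hmax : ∀ C ⊆ A, #C + #(B.biUnion N) ≤ #B + #(C.biUnion N) := fun C hC ↦ by
    have := hmax C (mem_powerset.2 hC)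
    omega
  rw [key B (mem_powerset.1 hB) hmax] at hmax
  have hNP : P ⊆ A.biUnion N := by
    intro D hD
    have hDW := hPsub D hD
    obtain ⟨x, hx, y, hy, hxy⟩ := hconn D (hDW.trans hWV) (hPc D hD).1
      (by rintro rfl; exact hWne (hWV.antisymm hDW))
    obtain ⟨hyV, hyD⟩ := mem_sdiff.1 hy
    by_cases hyW : y ∈ W
    · rw [← hPW] at hyW
      obtain ⟨E, hE, hyE⟩ := mem_biUnion.1 hyW
      exact absurd (hPj hD hE (by rintro rfl; exact hyD hyE) x hx y hyE) hxy
    · exact mem_biUnion.2 ⟨y, mem_sdiff.2 ⟨hyV, hyW⟩,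
        mem_filter.2 ⟨hD, x, hx, fun h ↦ hxy h.symm⟩⟩
  refine hAne (key ∅ (empty_subset _) fun C hC ↦ ?_).symm
  have := hmax C hC
  have := card_le_card hNP
  simp only [biUnion_empty, card_empty]
  omega

variable (G) in
lemma chromaticNumber_induce_eq_chromOn (W : Finset V) :
    (G.induce (W : Set V)).chromaticNumber = G.chromOn W := by
  refine le_antisymm ?_ ?_
  · obtain ⟨f, hf, hc⟩ := G.exists_isProperOn_card_eq_chromOn W
    rw [← hc]
    let C : (G.induce (W : Set V)).Coloring (W.image f) :=
      Coloring.mk (fun x ↦ ⟨f x, mem_image_of_mem f x.2⟩)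
        fun {x y} hxy h ↦ hf x x.2 y y.2 hxy (congrArg Subtype.val h)
    simpa using C.colorable.chromaticNumber_le
  · refine le_iInf₂ fun n hn ↦ ?_
    obtain ⟨C⟩ := hn
    let f : V → ℕ := fun x ↦ if h : x ∈ W then C ⟨x, h⟩ else 0
    have hf : G.IsProperOn W f := fun x hx y hy hxy h ↦ by
      simp only [f, hx, hy, dif_pos] at h
      exact C.valid (v := ⟨x, hx⟩) (w := ⟨y, hy⟩) hxy (Fin.ext h)
    have hsub : W.image f ⊆ range n := by
      intro c hc
      obtain ⟨x, hx, rfl⟩ := mem_image.1 hc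
      simp [f, hx]
    exact_mod_cast (chromOn_le hf).trans ((card_le_card hsub).trans (card_range n).le)

end SimpleGraph

/-- **Gallai's theorem on color-critical graphs**: if `G` is a finite graph
with connected complement and `χ(G - v) = χ(G) - 1` for every vertex `v`,
then `2χ(G) ≤ n + 1`. -/
theorem stmt_7 {V : Type*} [Fintype V] (G : SimpleGraph V)
    (hConn : Gᶜ.Connected)
    (hCrit : ∀ v : V,
      (G.induce ({v}ᶜ : Set V)).chromaticNumber = G.chromaticNumber - 1) :
    2 * G.chromaticNumber ≤ (Fintype.card V : ℕ∞) + 1 := by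
  classical
  have := hConn.nonempty
  have huniv : G.chromaticNumber = G.chromOn Finset.univ := by
    rw [← G.chromaticNumber_induce_eq_chromOn, Finset.coe_univ]
    exact (SimpleGraph.chromaticNumber_congr G.induceUnivIso).symm
  have hcrit : G.IsCriticalOn Finset.univ := by
    intro v _
    have hv := hCrit v
    have hpos := G.colorable_of_fintype.chromaticNumber_pos
    have hcoe : ({v}ᶜ : Set V) = (Finset.univ.erase v : Finset V) := by
      rw [Finset.coe_erase, Finset.coe_univ, Set.compl_eq_univ_sdiff]
    rw [hcoe, G.chromaticNumber_induce_eq_chromOn, huniv] at hv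
    rw [huniv] at hpos
    norm_cast at hv hpos
    omega
  have hconn : G.IsCoconnectedOn Finset.univ := by
    intro S _ ⟨u, hu⟩ hS
    obtain ⟨v, hv⟩ := not_forall.1 fun h ↦ hS (Finset.eq_univ_iff_forall.2 h)
    obtain ⟨p⟩ := hConn.preconnected u v
    obtain ⟨d, -, hd, hd'⟩ := p.exists_boundary_dart S hu hv
    exact ⟨d.fst, hd, d.snd, by simpa using hd', ((G.compl_adj _ _).1 d.adj).2⟩
  rw [huniv]
  exact_mod_cast hcrit.two_mul_chromOn_le Finset.univ_nonempty hconn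
end

section
/- Let G be a finite connected simple graph on n vertices and let θ(G) denote its clique cover number. If θ(G − v) = θ(G) − 1 for every vertex v, then 2·θ(G) ≤ n + 1. -/
/-- `θ(G)`: the minimum number of cliques of `G` needed to cover its vertex set. -/
noncomputable def cliqueCoverNumber {W : Type*} (G : SimpleGraph W) : ℕ :=
  sInf {k : ℕ | ∃ P : Finset (Set W),
    (∀ s ∈ P, G.IsClique s) ∧ (∀ v : W, ∃ s ∈ P, v ∈ s) ∧ P.card = k}

namespace SimpleGraph

variable {V : Type*} (G : SimpleGraph V)

/-- The minimum number of cliques of `G` needed to cover the vertices in `S`. -/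
noncomputable def cliqueCoverNumberOn (S : Finset V) : ℕ :=
  sInf {k : ℕ | ∃ P : Finset (Set V),
    (∀ s ∈ P, G.IsClique s) ∧ (∀ v ∈ S, ∃ s ∈ P, v ∈ s) ∧ P.card = k}

/-- No vertex of `S` is equal or adjacent to a vertex of `T`. -/
def Anticomplete (S T : Finset V) : Prop :=
  ∀ s ∈ S, ∀ t ∈ T, s ≠ t ∧ ¬ G.Adj s t

variable {G}

lemma Anticomplete.symm {S T : Finset V} (h : G.Anticomplete S T) : G.Anticomplete T S :=
  fun t ht s hs => ⟨(h s hs t ht).1.symm, fun e => (h s hs t ht).2 e.symm⟩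

lemma Anticomplete.mono {S T S' T' : Finset V} (h : G.Anticomplete S T) (hS : S' ⊆ S)
    (hT : T' ⊆ T) : G.Anticomplete S' T' :=
  fun s hs t ht => h s (hS hs) t (hT ht)

lemma cliqueCoverNumberOn_le {S : Finset V} {P : Finset (Set V)} (hP : ∀ s ∈ P, G.IsClique s)
    (hc : ∀ v ∈ S, ∃ s ∈ P, v ∈ s) : G.cliqueCoverNumberOn S ≤ P.card :=
  Nat.sInf_le ⟨P, hP, hc, rfl⟩

variable (G) in
lemma exists_cliqueCoverOn (S : Finset V) : ∃ P : Finset (Set V),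
    (∀ s ∈ P, G.IsClique s) ∧ (∀ v ∈ S, ∃ s ∈ P, v ∈ s) ∧
      P.card = G.cliqueCoverNumberOn S := by
  classical
  refine Nat.sInf_mem (s := {k : ℕ | ∃ P : Finset (Set V),
    (∀ s ∈ P, G.IsClique s) ∧ (∀ v ∈ S, ∃ s ∈ P, v ∈ s) ∧ P.card = k})
    ⟨_, S.image (fun v => ({v} : Set V)), ?_, ?_, rfl⟩
  · intro s hs
    obtain ⟨v, -, rfl⟩ := Finset.mem_image.1 hs
    exact Set.pairwise_singleton _ _
  · exact fun v hv => ⟨{v}, Finset.mem_image_of_mem _ hv, rfl⟩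

lemma cliqueCoverNumberOn_mono {S T : Finset V} (h : S ⊆ T) :
    G.cliqueCoverNumberOn S ≤ G.cliqueCoverNumberOn T := by
  obtain ⟨P, hP, hc, hk⟩ := G.exists_cliqueCoverOn T
  exact hk ▸ cliqueCoverNumberOn_le hP fun v hv => hc v (h hv)

lemma cliqueCoverNumberOn_empty : G.cliqueCoverNumberOn ∅ = 0 :=
  Nat.le_zero.1 (cliqueCoverNumberOn_le (P := ∅) (by simp) (by simp))

lemma IsClique.cliqueCoverNumberOn_le_one {S : Finset V} (h : G.IsClique (S : Set V)) :
    G.cliqueCoverNumberOn S ≤ 1 :=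
  cliqueCoverNumberOn_le (P := {(S : Set V)}) (by simpa using h) (by simp)

lemma cliqueCoverNumberOn_univ [Fintype V] :
    G.cliqueCoverNumberOn Finset.univ = cliqueCoverNumber G := by
  simp [cliqueCoverNumberOn, cliqueCoverNumber]

lemma cliqueCoverNumberOn_le_induce [Finite V] {S : Finset V} {s : Set V}
    (hs : ∀ v ∈ S, v ∈ s) :
    G.cliqueCoverNumberOn S ≤ cliqueCoverNumber (G.induce s) := by
  classical
  obtain ⟨P, hP, hc, hk⟩ := Nat.sInf_mem (s := {k : ℕ | ∃ P : Finset (Set s),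
    (∀ c ∈ P, (G.induce s).IsClique c) ∧ (∀ v : s, ∃ c ∈ P, v ∈ c) ∧ P.card = k}) <| by
      have := Fintype.ofFinite s
      refine ⟨_, Finset.univ.image (fun v => ({v} : Set s)), ?_, ?_, rfl⟩
      · intro c hc
        obtain ⟨v, -, rfl⟩ := Finset.mem_image.1 hc
        exact Set.pairwise_singleton _ _
      · exact fun v => ⟨{v}, Finset.mem_image_of_mem _ (Finset.mem_univ v), rfl⟩
  refine (cliqueCoverNumberOn_le (P := P.image fun c => Subtype.val '' c) ?_ ?_).trans
    (Finset.card_image_le.trans_eq hk)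
  · intro c hc
    obtain ⟨c, hcP, rfl⟩ := Finset.mem_image.1 hc
    rintro _ ⟨v, hv, rfl⟩ _ ⟨w, hw, rfl⟩ hne
    exact hP c hcP hv hw fun e => hne (congrArg _ e)
  · intro v hv
    obtain ⟨c, hcP, hvc⟩ := hc ⟨v, hs v hv⟩
    exact ⟨_, Finset.mem_image_of_mem _ hcP, ⟨v, hs v hv⟩, hvc, rfl⟩

lemma cliqueCoverNumberOn_pos {S : Finset V} (hS : S.Nonempty) :
    0 < G.cliqueCoverNumberOn S := by
  obtain ⟨P, -, hc, hk⟩ := G.exists_cliqueCoverOn S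
  obtain ⟨v, hv⟩ := hS
  obtain ⟨c, hcP, -⟩ := hc v hv
  exact hk ▸ Finset.card_pos.2 ⟨c, hcP⟩

variable [DecidableEq V]

lemma cliqueCoverNumberOn_union_le (S T : Finset V) :
    G.cliqueCoverNumberOn (S ∪ T) ≤ G.cliqueCoverNumberOn S + G.cliqueCoverNumberOn T := by
  classical
  obtain ⟨P, hP, hc, hk⟩ := G.exists_cliqueCoverOn S
  obtain ⟨Q, hQ, hd, hl⟩ := G.exists_cliqueCoverOn T
  rw [← hk, ← hl]
  refine (cliqueCoverNumberOn_le (P := P ∪ Q) ?_ ?_).trans (Finset.card_union_le _ _)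
  · grind
  · grind

lemma Anticomplete.add_le {S T : Finset V} (h : G.Anticomplete S T) :
    G.cliqueCoverNumberOn S + G.cliqueCoverNumberOn T ≤ G.cliqueCoverNumberOn (S ∪ T) := by
  classical
  obtain ⟨P, hP, hc, hk⟩ := G.exists_cliqueCoverOn (S ∪ T)
  have hS : G.cliqueCoverNumberOn S ≤ (P.filter fun s => ∃ v ∈ S, v ∈ s).card :=
    cliqueCoverNumberOn_le (fun s hs => hP s (Finset.mem_filter.1 hs).1) fun v hv =>
      let ⟨s, hs, hvs⟩ := hc v (by simp [hv])
      ⟨s, Finset.mem_filter.2 ⟨hs, v, hv, hvs⟩, hvs⟩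
  have hT : G.cliqueCoverNumberOn T ≤ (P.filter fun s => ∃ v ∈ T, v ∈ s).card :=
    cliqueCoverNumberOn_le (fun s hs => hP s (Finset.mem_filter.1 hs).1) fun v hv =>
      let ⟨s, hs, hvs⟩ := hc v (by simp [hv])
      ⟨s, Finset.mem_filter.2 ⟨hs, v, hv, hvs⟩, hvs⟩
  have hd : Disjoint (P.filter fun s => ∃ v ∈ S, v ∈ s) (P.filter fun s => ∃ v ∈ T, v ∈ s) := by
    refine Finset.disjoint_left.2 fun s hs ht => ?_
    obtain ⟨hsP, v, hv, hvs⟩ := Finset.mem_filter.1 hs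
    obtain ⟨-, w, hw, hws⟩ := Finset.mem_filter.1 ht
    exact (h v hv w hw).2 (hP s hsP hvs hws (h v hv w hw).1)
  calc _ ≤ _ := add_le_add hS hT
    _ = _ := (Finset.card_union_of_disjoint hd).symm
    _ ≤ P.card := Finset.card_le_card (by grind)
    _ = _ := hk

lemma cliqueCoverNumberOn_biUnion_le {ι : Type*} [DecidableEq ι] (I : Finset ι)
    (C : ι → Finset V) :
    G.cliqueCoverNumberOn (I.biUnion C) ≤ ∑ i ∈ I, G.cliqueCoverNumberOn (C i) := by
  induction I using Finset.induction_on with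
  | empty => simp [cliqueCoverNumberOn_empty]
  | insert i I hi ih =>
    rw [Finset.biUnion_insert, Finset.sum_insert hi]
    exact (cliqueCoverNumberOn_union_le _ _).trans (by gcongr)

lemma sum_cliqueCoverNumberOn_le_biUnion {ι : Type*} [DecidableEq ι] (I : Finset ι)
    (C : ι → Finset V) (h : ∀ i ∈ I, ∀ j ∈ I, i ≠ j → G.Anticomplete (C i) (C j)) :
    ∑ i ∈ I, G.cliqueCoverNumberOn (C i) ≤ G.cliqueCoverNumberOn (I.biUnion C) := by
  induction I using Finset.induction_on with
  | empty => simp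
  | insert i I hi ih =>
    rw [Finset.biUnion_insert, Finset.sum_insert hi]
    have hanti : G.Anticomplete (C i) (I.biUnion C) := by
      intro s hs t ht
      obtain ⟨j, hj, htj⟩ := Finset.mem_biUnion.1 ht
      exact h i (by simp) j (by simp [hj]) (by rintro rfl; exact hi hj) s hs t htj
    refine le_trans ?_ hanti.add_le
    have := ih fun i hi j hj => h i (by simp [hi]) j (by simp [hj])
    gcongr

lemma cliqueCoverNumberOn_le_erase_add_one (S : Finset V) (v : V) :
    G.cliqueCoverNumberOn S ≤ G.cliqueCoverNumberOn (S.erase v) + 1 := by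
  have h1 : G.cliqueCoverNumberOn {v} ≤ 1 :=
    IsClique.cliqueCoverNumberOn_le_one (by simp)
  have h2 := cliqueCoverNumberOn_union_le (G := G) (S.erase v) {v}
  have h3 : S ⊆ S.erase v ∪ {v} := by grind
  have h4 := cliqueCoverNumberOn_mono (G := G) h3
  omega

variable (G) in
/-- Deleting any vertex of `S` decreases the number of cliques needed to cover `S`. -/
def CliqueCoverCritical (S : Finset V) : Prop :=
  ∀ v ∈ S, G.cliqueCoverNumberOn (S.erase v) < G.cliqueCoverNumberOn S

lemma exists_cliqueCoverCritical_subset (T : Finset V) :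
    ∃ H ⊆ T, G.cliqueCoverNumberOn H = G.cliqueCoverNumberOn T ∧ G.CliqueCoverCritical H := by
  induction T using Finset.strongInduction with
  | H T ih =>
    by_cases hT : G.CliqueCoverCritical T
    · exact ⟨T, subset_rfl, rfl, hT⟩
    · simp only [CliqueCoverCritical, not_forall, not_lt] at hT
      obtain ⟨v, hv, hle⟩ := hT
      obtain ⟨H, hH, he, hc⟩ := ih _ (Finset.erase_ssubset hv)
      exact ⟨H, hH.trans (Finset.erase_subset _ _),
        he.trans ((cliqueCoverNumberOn_mono (Finset.erase_subset _ _)).antisymm hle), hc⟩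

lemma CliqueCoverCritical.insert_le {C : Finset V} (hC : G.CliqueCoverCritical C) {v a : V}
    (hv : v ∈ C) (ha : G.Adj v a) :
    G.cliqueCoverNumberOn (insert a C) ≤ G.cliqueCoverNumberOn C := by
  have h1 : G.cliqueCoverNumberOn {v, a} ≤ 1 :=
    IsClique.cliqueCoverNumberOn_le_one (by simp [ha])
  have h2 := cliqueCoverNumberOn_union_le (G := G) (C.erase v) {v, a}
  have h3 : insert a C ⊆ C.erase v ∪ {v, a} := by grind
  have h4 := cliqueCoverNumberOn_mono (G := G) h3
  have h5 := hC v hv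
  omega

lemma CliqueCoverCritical.left_of_anticomplete {S T : Finset V}
    (h : G.CliqueCoverCritical (S ∪ T)) (hST : G.Anticomplete S T) :
    G.CliqueCoverCritical S := by
  intro v hv
  have h1 := h v (Finset.mem_union_left _ hv)
  have h2 : S.erase v ∪ T ⊆ (S ∪ T).erase v := by
    have := fun t ht => (hST v hv t ht).1
    grind
  have h3 := cliqueCoverNumberOn_mono (G := G) h2
  have h4 := (hST.mono (Finset.erase_subset v S) subset_rfl).add_le
  have h5 := cliqueCoverNumberOn_union_le (G := G) S T
  omega

lemma CliqueCoverCritical.eq_empty_of_le {S D B : Finset V} (h : G.CliqueCoverCritical S)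
    (hD : D ⊆ S) (hB : B ⊆ S) (hDB : Disjoint D B)
    (hle : G.cliqueCoverNumberOn (D ∪ B) ≤ G.cliqueCoverNumberOn D)
    (hanti : G.Anticomplete D (S \ (D ∪ B))) : B = ∅ := by
  by_contra hne
  obtain ⟨b, hb⟩ := Finset.nonempty_iff_ne_empty.2 hne
  have h1 := h b (hB hb)
  have h2 := cliqueCoverNumberOn_union_le (G := G) (D ∪ B) (S \ (D ∪ B))
  rw [Finset.union_sdiff_of_subset (Finset.union_subset hD hB)] at h2
  have h3 := hanti.add_le
  have h4 : D ∪ S \ (D ∪ B) ⊆ S.erase b := by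
    have := Finset.disjoint_left.1 hDB
    grind
  have h5 := cliqueCoverNumberOn_mono (G := G) h4
  omega

end SimpleGraph

/-- In a minimal violation of Hall's condition, after removing any one index the remaining ones
have a system of representatives that exhausts all the sets. -/
lemma Finset.exists_subset_forall_image_erase_eq_biUnion {ι α : Type*} [DecidableEq ι]
    [DecidableEq α] [Nonempty α] (t : ι → Finset α) (I : Finset ι) (h : (I.biUnion t).card < I.card) :
    ∃ J ⊆ I, J.Nonempty ∧ ∀ i ∈ J, ∃ g : ι → α, (∀ j ∈ J.erase i, g j ∈ t j) ∧
      (J.erase i).image g = J.biUnion t := by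
  induction I using Finset.strongInduction with
  | H I ih =>
    by_cases hJ : ∃ J ⊂ I, (J.biUnion t).card < J.card
    · obtain ⟨J, hJI, hJ⟩ := hJ
      obtain ⟨K, hK, hK'⟩ := ih J hJI hJ
      exact ⟨K, hK.trans hJI.1, hK'⟩
    push Not at hJ
    refine ⟨I, subset_rfl, Finset.card_pos.1 (by omega), fun i hi => ?_⟩
    have hall : ∀ s : Finset {j // j ∈ I.erase i},
        s.card ≤ (s.biUnion fun j => t j).card := by
      intro s
      have h1 := hJ (s.image Subtype.val) <| by
        refine Finset.ssubset_iff_subset_ne.2 ⟨by grind, ?_⟩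
        intro he
        obtain ⟨j, -, hj⟩ := Finset.mem_image.1 (he.symm ▸ hi)
        exact (Finset.mem_erase.1 j.2).1 hj
      rwa [Finset.card_image_of_injective _ Subtype.val_injective, Finset.image_biUnion] at h1
    obtain ⟨f, hf, hft⟩ := (Finset.all_card_le_biUnion_card_iff_exists_injective _).1 hall
    have hcard := Finset.card_erase_of_mem hi
    have himg : (Finset.univ.image f) = I.biUnion t := by
      refine Finset.eq_of_subset_of_card_le ?_ ?_
      · intro a ha
        obtain ⟨j, -, rfl⟩ := Finset.mem_image.1 ha
        exact Finset.mem_biUnion.2 ⟨j, Finset.mem_of_mem_erase j.2, hft j⟩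
      · rw [Finset.card_image_of_injective _ hf, Finset.card_univ, Fintype.card_coe]
        omega
    refine ⟨fun j => if h : j ∈ I.erase i then f ⟨j, h⟩ else Classical.arbitrary α,
      fun j hj => by simpa only [dif_pos hj] using hft ⟨j, hj⟩, ?_⟩
    rw [← himg]
    ext a
    simp only [Finset.mem_image, Finset.mem_univ, true_and, Subtype.exists]
    exact ⟨fun ⟨j, hj, he⟩ => ⟨j, hj, by rwa [dif_pos hj] at he⟩,
      fun ⟨j, hj, he⟩ => ⟨j, hj, by rwa [dif_pos hj]⟩⟩

namespace SimpleGraph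

variable {V : Type*} {G : SimpleGraph V} [DecidableEq V]

/-- If `S` is critical and does not split into two anticomplete parts, and every critical proper
subset decomposes into anticomplete critical parts satisfying the bound, then so does `S`. -/
lemma CliqueCoverCritical.two_mul_le {S : Finset V} (hS : G.CliqueCoverCritical S)
    (hconn : ∀ D ⊆ S, D.Nonempty → G.Anticomplete D (S \ D) → D = S)
    (ih : ∀ H ⊂ S, G.CliqueCoverCritical H → ∃ 𝓒 : Finset (Finset V),
      (∀ C ∈ 𝓒, ∀ C' ∈ 𝓒, C ≠ C' → G.Anticomplete C C') ∧ 𝓒.biUnion id = H ∧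
      ∀ C ∈ 𝓒, C.Nonempty ∧ G.CliqueCoverCritical C ∧
        2 * G.cliqueCoverNumberOn C ≤ C.card + 1) :
    2 * G.cliqueCoverNumberOn S ≤ S.card + 1 := by
  classical
  rcases S.eq_empty_or_nonempty with rfl | ⟨x, hx⟩
  · simp [cliqueCoverNumberOn_empty]
  obtain ⟨H, hHS, hθ, hHc⟩ := exists_cliqueCoverCritical_subset (G := G) (S.erase x)
  obtain ⟨𝓒, hanti, hun, h𝓒⟩ := ih H (hHS.trans_ssubset (Finset.erase_ssubset hx)) hHc
  have hxcard := Finset.card_erase_of_mem hx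
  have hxpos : 0 < S.card := Finset.card_pos.2 ⟨x, hx⟩
  set U := S.erase x \ H with hU
  have hUcard : U.card + H.card = (S.erase x).card := Finset.card_sdiff_add_card_eq_card hHS
  by_cases hcard : 𝓒.card ≤ U.card
  · have h1 := cliqueCoverNumberOn_biUnion_le (G := G) 𝓒 id
    have h2 : ∑ C ∈ 𝓒, 2 * G.cliqueCoverNumberOn C ≤ ∑ C ∈ 𝓒, (C.card + 1) :=
      Finset.sum_le_sum fun C hC => (h𝓒 C hC).2.2
    have h3 : H.card = ∑ C ∈ 𝓒, C.card := by
      rw [← hun]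
      refine Finset.card_biUnion fun C hC C' hC' hne => ?_
      exact Finset.disjoint_left.2 fun v hv hv' => (hanti C hC C' hC' hne v hv v hv').1 rfl
    rw [Finset.sum_add_distrib, ← Finset.mul_sum, ← h3, Finset.sum_const, smul_eq_mul,
      mul_one] at h2
    have h4 := cliqueCoverNumberOn_le_erase_add_one (G := G) S x
    rw [hun] at h1
    simp only [id] at h1
    omega
  exfalso
  let t : Finset V → Finset V := fun C => U.filter fun a => ∃ v ∈ C, G.Adj v a
  have hlt : (𝓒.biUnion t).card < 𝓒.card :=
    (Finset.card_le_card (Finset.biUnion_subset.2 fun C _ =>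
      Finset.filter_subset _ _)).trans_lt (not_le.1 hcard)
  have : Nonempty V := ⟨x⟩
  obtain ⟨I, hI, hIne, hg⟩ := Finset.exists_subset_forall_image_erase_eq_biUnion t 𝓒 hlt
  set D := I.biUnion id with hD
  have hDH : D ⊆ H := hun ▸ Finset.biUnion_subset_biUnion_of_subset_left _ hI
  have hDS : D ⊆ S := fun v hv => Finset.mem_of_mem_erase (hHS (hDH hv))
  have hxD : x ∉ D := fun h => Finset.notMem_erase x S (hHS (hDH h))
  have hAU : I.biUnion t ⊆ U := Finset.biUnion_subset.2 fun C _ => Finset.filter_subset _ _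
  have hAS : I.biUnion t ⊆ S := fun v hv =>
    Finset.mem_of_mem_erase (Finset.mem_sdiff.1 (hAU hv)).1
  have hDA : Disjoint D (I.biUnion t) :=
    Finset.disjoint_left.2 fun v hv hv' => (Finset.mem_sdiff.1 (hAU hv')).2 (hDH hv)
  have hsum : ∑ C ∈ I, G.cliqueCoverNumberOn C ≤ G.cliqueCoverNumberOn D :=
    sum_cliqueCoverNumberOn_le_biUnion I id fun C hC C' hC' => hanti C (hI hC) C' (hI hC')
  have hcover : ∀ C₀ ∈ I, ∀ C₁ : Finset V,
      G.cliqueCoverNumberOn C₁ ≤ G.cliqueCoverNumberOn C₀ →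
      G.cliqueCoverNumberOn (C₁ ∪ (I.erase C₀).biUnion id ∪ I.biUnion t) ≤
        G.cliqueCoverNumberOn D := by
    intro C₀ hC₀ C₁ hC₁
    obtain ⟨g, hgt, himg⟩ := hg C₀ hC₀
    have h1 : G.cliqueCoverNumberOn ((I.erase C₀).biUnion fun C => insert (g C) C) ≤
        ∑ C ∈ I.erase C₀, G.cliqueCoverNumberOn C := by
      refine (cliqueCoverNumberOn_biUnion_le _ _).trans (Finset.sum_le_sum fun C hC => ?_)
      obtain ⟨-, v, hv, hadj⟩ := Finset.mem_filter.1 (hgt C hC)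
      exact (h𝓒 C (hI (Finset.mem_of_mem_erase hC))).2.1.insert_le hv hadj
    have h2 := cliqueCoverNumberOn_union_le (G := G) C₁
      ((I.erase C₀).biUnion fun C => insert (g C) C)
    have h3 : C₁ ∪ (I.erase C₀).biUnion id ∪ I.biUnion t ⊆
        C₁ ∪ (I.erase C₀).biUnion fun C => insert (g C) C := by
      rw [← himg]
      intro v
      simp only [Finset.mem_union, Finset.mem_biUnion, Finset.mem_image, Finset.mem_insert, id]
      rintro ((h | ⟨C, hC, hv⟩) | ⟨C, hC, rfl⟩)
      · exact Or.inl h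
      · exact Or.inr ⟨C, hC, Or.inr hv⟩
      · exact Or.inr ⟨C, hC, Or.inl rfl⟩
    have h4 := cliqueCoverNumberOn_mono (G := G) h3
    have h5 := Finset.add_sum_erase I (fun C => G.cliqueCoverNumberOn C) hC₀
    omega
  have hsplit : ∀ C₀ ∈ I, D = C₀ ∪ (I.erase C₀).biUnion id := by
    intro C₀ hC₀
    conv_lhs => rw [hD, ← Finset.insert_erase hC₀, Finset.biUnion_insert, id]
  have hnbr : ∀ v ∈ D, ∀ w ∈ S, w ∉ D → w ∉ I.biUnion t → w ≠ x → ¬ G.Adj v w := by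
    intro v hv w hw hwD hwA hwx hadj
    obtain ⟨C, hC, hvC⟩ := Finset.mem_biUnion.1 hv
    by_cases hwH : w ∈ H
    · rw [← hun] at hwH
      obtain ⟨C', hC', hwC'⟩ := Finset.mem_biUnion.1 hwH
      refine (hanti C (hI hC) C' hC' ?_ v hvC w hwC').2 hadj
      rintro rfl
      exact hwD (Finset.mem_biUnion.2 ⟨C, hC, hwC'⟩)
    · exact hwA (Finset.mem_biUnion.2 ⟨C, hC, Finset.mem_filter.2
        ⟨Finset.mem_sdiff.2 ⟨Finset.mem_erase.2 ⟨hwx, hw⟩, hwH⟩, v, hvC, hadj⟩⟩)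
  by_cases hxadj : ∃ v ∈ D, G.Adj v x
  · obtain ⟨v, hv, hadj⟩ := hxadj
    obtain ⟨C₀, hC₀, hvC₀⟩ := Finset.mem_biUnion.1 hv
    have hle := hcover C₀ hC₀ _ ((h𝓒 C₀ (hI hC₀)).2.1.insert_le hvC₀ hadj)
    rw [Finset.insert_union, ← hsplit C₀ hC₀, Finset.insert_union, ← Finset.union_insert] at hle
    refine Finset.insert_ne_empty x _ (hS.eq_empty_of_le hDS (Finset.insert_subset hx hAS)
      (Finset.disjoint_insert_right.2 ⟨hxD, hDA⟩) hle ?_)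
    intro v hv w hw
    simp only [Finset.mem_sdiff, Finset.mem_union, Finset.mem_insert, not_or] at hw
    exact ⟨fun e => hw.2.1 (e ▸ hv), hnbr v hv w hw.1 hw.2.1 hw.2.2.2 hw.2.2.1⟩
  · push Not at hxadj
    obtain ⟨C₀, hC₀⟩ := hIne
    have hle := hcover C₀ hC₀ C₀ le_rfl
    rw [← hsplit C₀ hC₀] at hle
    have hanti' : G.Anticomplete D (S \ (D ∪ I.biUnion t)) := by
      intro v hv w hw
      simp only [Finset.mem_sdiff, Finset.mem_union, not_or] at hw
      refine ⟨fun e => hw.2.1 (e ▸ hv), ?_⟩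
      by_cases hwx : w = x
      · exact hwx ▸ hxadj v hv
      · exact hnbr v hv w hw.1 hw.2.1 hw.2.2 hwx
    have hA := hS.eq_empty_of_le hDS hAS hDA hle hanti'
    rw [hA, Finset.union_empty] at hanti'
    obtain ⟨v, hv⟩ := (h𝓒 C₀ (hI hC₀)).1
    exact hxD (hconn D hDS ⟨v, Finset.mem_biUnion.2 ⟨C₀, hC₀, hv⟩⟩ hanti' ▸ hx)

lemma CliqueCoverCritical.exists_decomposition (S : Finset V) (hS : G.CliqueCoverCritical S) :
    ∃ 𝓒 : Finset (Finset V),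
      (∀ C ∈ 𝓒, ∀ C' ∈ 𝓒, C ≠ C' → G.Anticomplete C C') ∧ 𝓒.biUnion id = S ∧
      ∀ C ∈ 𝓒, C.Nonempty ∧ G.CliqueCoverCritical C ∧
        2 * G.cliqueCoverNumberOn C ≤ C.card + 1 := by
  induction S using Finset.strongInduction with
  | H S ih =>
    rcases S.eq_empty_or_nonempty with rfl | hne
    · exact ⟨∅, by simp⟩
    by_cases hconn : ∀ D ⊆ S, D.Nonempty → G.Anticomplete D (S \ D) → D = S
    · exact ⟨{S}, by simp, by simp, by simpa using ⟨hne, hS, hS.two_mul_le hconn ih⟩⟩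
    push Not at hconn
    obtain ⟨D, hDS, hDne, hanti, hD⟩ := hconn
    have hu : D ∪ S \ D = S := Finset.union_sdiff_of_subset hDS
    obtain ⟨𝓐, h𝓐, hA, h𝓐'⟩ := ih D (hDS.ssubset_of_ne hD)
      ((hu.symm ▸ hS : G.CliqueCoverCritical (D ∪ S \ D)).left_of_anticomplete hanti)
    obtain ⟨𝓑, h𝓑, hB, h𝓑'⟩ := ih (S \ D) (Finset.sdiff_ssubset hDS hDne)
      ((((Finset.union_comm _ _).trans hu).symm ▸ hS :
        G.CliqueCoverCritical (S \ D ∪ D)).left_of_anticomplete hanti.symm)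
    have hsubA : ∀ C ∈ 𝓐, C ⊆ D := fun C hC => hA ▸ Finset.subset_biUnion_of_mem id hC
    have hsubB : ∀ C ∈ 𝓑, C ⊆ S \ D := fun C hC => hB ▸ Finset.subset_biUnion_of_mem id hC
    refine ⟨𝓐 ∪ 𝓑, ?_, ?_, ?_⟩
    · intro C hC C' hC' hne
      rcases Finset.mem_union.1 hC with h | h <;> rcases Finset.mem_union.1 hC' with h' | h'
      · exact h𝓐 C h C' h' hne
      · exact hanti.mono (hsubA C h) (hsubB C' h')
      · exact hanti.symm.mono (hsubB C h) (hsubA C' h')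
      · exact h𝓑 C h C' h' hne
    · rw [Finset.union_biUnion, hA, hB, hu]
    · intro C hC
      exact (Finset.mem_union.1 hC).elim (h𝓐' C) (h𝓑' C)

end SimpleGraph

/-- If `G` is a finite connected graph with `θ(G - v) = θ(G) - 1` for every
vertex `v`, then `2θ(G) ≤ n + 1`. -/
theorem stmt_8 {V : Type*} [Fintype V] (G : SimpleGraph V)
    (hConn : G.Connected)
    (hCrit : ∀ v : V,
      cliqueCoverNumber (G.induce ({v}ᶜ : Set V)) = cliqueCoverNumber G - 1) :
    2 * cliqueCoverNumber G ≤ Fintype.card V + 1 := by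
  classical
  obtain ⟨v₀⟩ := hConn.nonempty
  have hpos := SimpleGraph.cliqueCoverNumberOn_pos (G := G) (S := Finset.univ) ⟨v₀, by simp⟩
  have hcrit : G.CliqueCoverCritical Finset.univ := by
    intro v _
    have h1 : G.cliqueCoverNumberOn (Finset.univ.erase v) ≤
        cliqueCoverNumber (G.induce ({v}ᶜ : Set V)) :=
      SimpleGraph.cliqueCoverNumberOn_le_induce (by simp)
    rw [hCrit v, ← SimpleGraph.cliqueCoverNumberOn_univ] at h1
    omega
  obtain ⟨𝓒, hanti, hun, h𝓒⟩ := hcrit.exists_decomposition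
  obtain ⟨C, hC, hv₀⟩ := Finset.mem_biUnion.1 (hun.symm ▸ Finset.mem_univ v₀)
  have hclosed : ∀ v w, v ∈ C → G.Adj v w → w ∈ C := by
    intro v w hv hadj
    obtain ⟨C', hC', hw⟩ := Finset.mem_biUnion.1 (hun.symm ▸ Finset.mem_univ w)
    by_contra hwC
    exact (hanti C hC C' hC' (by rintro rfl; exact hwC hw) v hv w hw).2 hadj
  have hall : C = Finset.univ := by
    refine Finset.eq_univ_iff_forall.2 fun w => ?_
    obtain ⟨p⟩ := hConn.preconnected v₀ w
    clear hun
    induction p with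
    | nil => exact hv₀
    | cons h p ih => exact ih (hclosed _ _ hv₀ h)
  have h := (h𝓒 C hC).2.2
  rwa [hall, SimpleGraph.cliqueCoverNumberOn_univ, Finset.card_univ] at h
end

section
/- Let k ≥ 2 be an integer and let G be a finite simple graph on n vertices whose complement is connected. Let χ_k(G) denote the minimum number of parts in a partition of the vertex set of G into independent sets each of size at most k. If χ_k(G − v) = χ_k(G) − 1 for every vertex v, then 2·χ_k(G) ≤ n + 1. -/
/-- `χ_k(G)`: the minimum number of parts in a partition of the vertex set of
`G` into independent sets each of cardinality at most `k`. -/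
noncomputable def boundedChromaticNumber {W : Type*} (G : SimpleGraph W) (k : ℕ) : ℕ :=
  sInf {m : ℕ | ∃ P : Finset (Set W),
    (∀ s ∈ P, (s.Pairwise fun u v => ¬ G.Adj u v) ∧ s.ncard ≤ k) ∧
    (∀ v : W, ∃ s ∈ P, v ∈ s) ∧
    (↑P : Set (Set W)).Pairwise Disjoint ∧ P.card = m}

open Classical in
/-- A monotone subadditive set function `ρ` on vertex sets, superadditive on pairs of
sets with no edges between them and at most `1` on vertices and edges of `H`. -/
structure IsCoverFunction {V : Type*} (H : SimpleGraph V) (ρ : Finset V → ℕ) : Prop where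
  mono : ∀ {X Y : Finset V}, X ⊆ Y → ρ X ≤ ρ Y
  union_le : ∀ X Y : Finset V, ρ (X ∪ Y) ≤ ρ X + ρ Y
  add_le : ∀ X Y : Finset V, Disjoint X Y → (∀ x ∈ X, ∀ y ∈ Y, ¬ H.Adj x y) →
    ρ X + ρ Y ≤ ρ (X ∪ Y)
  singleton_le : ∀ v, ρ {v} ≤ 1
  pair_le : ∀ u v, H.Adj u v → ρ {u, v} ≤ 1

namespace IsCoverFunction

open Finset

variable {V : Type*} {H : SimpleGraph V} {ρ : Finset V → ℕ}

open Classical in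
/-- Deleting any vertex of `X` decreases `ρ`. -/
def Critical (ρ : Finset V → ℕ) (X : Finset V) : Prop := ∀ v ∈ X, ρ (X.erase v) < ρ X

/-- `X` induces a connected (possibly empty) subgraph of `H`, expressed through cuts. -/
def Inseparable (H : SimpleGraph V) (X : Finset V) : Prop :=
  ∀ Y ⊆ X, Y.Nonempty → Y ≠ X → ∃ y ∈ Y, ∃ z ∈ X, z ∉ Y ∧ H.Adj y z

/-- A decomposition of a vertex set into nonempty critical pieces `K` with
`2 * ρ K ≤ |K| + 1` and with no edges between different pieces. -/
structure IsDecomposition (H : SimpleGraph V) (ρ : Finset V → ℕ) (𝒟 : Finset (Finset V)) :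
    Prop where
  nonempty : ∀ K ∈ 𝒟, K.Nonempty
  critical : ∀ K ∈ 𝒟, Critical ρ K
  two_mul_le : ∀ K ∈ 𝒟, 2 * ρ K ≤ K.card + 1
  disjoint : ∀ K ∈ 𝒟, ∀ L ∈ 𝒟, K ≠ L → Disjoint K L
  not_adj : ∀ K ∈ 𝒟, ∀ L ∈ 𝒟, K ≠ L → ∀ x ∈ K, ∀ y ∈ L, ¬ H.Adj x y

theorem IsDecomposition.subset {𝒟 ℰ : Finset (Finset V)} (h : IsDecomposition H ρ 𝒟)
    (hs : ℰ ⊆ 𝒟) : IsDecomposition H ρ ℰ :=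
  ⟨fun K hK => h.nonempty K (hs hK), fun K hK => h.critical K (hs hK),
    fun K hK => h.two_mul_le K (hs hK),
    fun K hK L hL => h.disjoint K (hs hK) L (hs hL),
    fun K hK L hL => h.not_adj K (hs hK) L (hs hL)⟩

open Classical in
theorem IsDecomposition.union {𝒟 ℰ : Finset (Finset V)} (h𝒟 : IsDecomposition H ρ 𝒟)
    (hℰ : IsDecomposition H ρ ℰ) (hd : Disjoint (𝒟.biUnion id) (ℰ.biUnion id))
    (ha : ∀ x ∈ 𝒟.biUnion id, ∀ y ∈ ℰ.biUnion id, ¬ H.Adj x y) :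
    IsDecomposition H ρ (𝒟 ∪ ℰ) := by
  have hmem : ∀ {𝒦 : Finset (Finset V)} {K : Finset V}, K ∈ 𝒦 → K ⊆ 𝒦.biUnion id :=
    fun hK => subset_biUnion_of_mem id hK
  refine ⟨?_, ?_, ?_, ?_, ?_⟩
  · intro K hK
    exact (mem_union.1 hK).elim (h𝒟.nonempty K) (hℰ.nonempty K)
  · intro K hK
    exact (mem_union.1 hK).elim (h𝒟.critical K) (hℰ.critical K)
  · intro K hK
    exact (mem_union.1 hK).elim (h𝒟.two_mul_le K) (hℰ.two_mul_le K)
  · intro K hK L hL hne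
    rcases mem_union.1 hK with hK | hK <;> rcases mem_union.1 hL with hL | hL
    · exact h𝒟.disjoint K hK L hL hne
    · exact hd.mono (hmem hK) (hmem hL)
    · exact (hd.mono (hmem hL) (hmem hK)).symm
    · exact hℰ.disjoint K hK L hL hne
  · intro K hK L hL hne x hx y hy
    rcases mem_union.1 hK with hK | hK <;> rcases mem_union.1 hL with hL | hL
    · exact h𝒟.not_adj K hK L hL hne x hx y hy
    · exact ha x (hmem hK hx) y (hmem hL hy)
    · exact fun h => ha y (hmem hL hy) x (hmem hK hx) h.symm
    · exact hℰ.not_adj K hK L hL hne x hx y hy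

theorem map_empty (h : IsCoverFunction H ρ) : ρ ∅ = 0 := by
  have := h.add_le ∅ ∅ (by simp) (by simp)
  simp at this
  exact this

open Classical in
theorem le_erase_add_one (h : IsCoverFunction H ρ) {X : Finset V} {v : V} (hv : v ∈ X) :
    ρ X ≤ ρ (X.erase v) + 1 := by
  have h1 := h.union_le (X.erase v) {v}
  have h2 := h.singleton_le v
  rw [union_comm, ← insert_eq, insert_erase hv] at h1
  omega

open Classical in
theorem biUnion_le_sum (h : IsCoverFunction H ρ) {ι : Type*} (s : Finset ι)
    (f : ι → Finset V) : ρ (s.biUnion f) ≤ ∑ i ∈ s, ρ (f i) := by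
  induction s using Finset.induction_on with
  | empty => simp [h.map_empty]
  | insert a s ha ih =>
    rw [biUnion_insert, sum_insert ha]
    have := h.union_le (f a) (s.biUnion f)
    omega

open Classical in
theorem sum_le_biUnion (h : IsCoverFunction H ρ) {𝒟 : Finset (Finset V)}
    (h𝒟 : IsDecomposition H ρ 𝒟) : ∑ K ∈ 𝒟, ρ K ≤ ρ (𝒟.biUnion id) := by
  induction 𝒟 using Finset.induction_on with
  | empty => simp
  | insert K 𝒟 hK ih =>
    rw [biUnion_insert, sum_insert hK]
    have ih := ih (h𝒟.subset (subset_insert _ _))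
    have hne : ∀ L ∈ 𝒟, K ≠ L := fun L hL e => hK (e ▸ hL)
    have := h.add_le (id K) (𝒟.biUnion id)
      ((disjoint_biUnion_right _ _ _).2 fun L hL =>
        h𝒟.disjoint K (mem_insert_self _ _) L (mem_insert_of_mem hL) (hne L hL))
      (fun x hx y hy => by
        obtain ⟨L, hL, hyL⟩ := mem_biUnion.1 hy
        exact h𝒟.not_adj K (mem_insert_self _ _) L (mem_insert_of_mem hL) (hne L hL) x hx y hyL)
    exact (Nat.add_le_add_left ih _).trans this

open Classical in
/-- Expansion property of critical sets. -/
theorem lt_of_critical (h : IsCoverFunction H ρ) {X D N : Finset V} (hX : Critical ρ X)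
    (hD : D ⊆ X) (hN : N ⊆ X) (hDN : Disjoint D N) (hne : N.Nonempty)
    (hadj : ∀ x ∈ D, ∀ y ∈ X, y ∉ D ∪ N → ¬ H.Adj x y) : ρ D < ρ (D ∪ N) := by
  obtain ⟨y, hy⟩ := hne
  have h1 := h.add_le D (X \ (D ∪ N))
    (disjoint_sdiff.mono_left subset_union_left)
    (fun x hx z hz => hadj x hx z (mem_sdiff.1 hz).1 (mem_sdiff.1 hz).2)
  have h2 : ρ (D ∪ X \ (D ∪ N)) ≤ ρ (X.erase y) := by
    refine h.mono (union_subset ?_ ?_)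
    · exact fun x hx => mem_erase.2 ⟨fun e => disjoint_left.1 hDN hx (e ▸ hy), hD hx⟩
    · intro x hx
      refine mem_erase.2 ⟨fun e => ?_, (mem_sdiff.1 hx).1⟩
      exact (mem_sdiff.1 hx).2 (mem_union_right _ (e ▸ hy))
  have h3 := hX y (hN hy)
  have h4 := h.union_le (D ∪ N) (X \ (D ∪ N))
  rw [union_sdiff_of_subset (union_subset hD hN)] at h4
  omega

open Classical in
theorem insert_le_of_critical (h : IsCoverFunction H ρ) {K : Finset V} (hK : Critical ρ K)
    {a z : V} (hz : z ∈ K) (haz : H.Adj a z) : ρ (insert a K) ≤ ρ K := by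
  have h1 := h.union_le {a, z} (K.erase z)
  have h2 := h.pair_le a z haz
  have h3 := hK z hz
  have h4 : insert a K = {a, z} ∪ K.erase z := by
    rw [insert_union, ← insert_eq, insert_erase hz]
  rw [h4]
  omega

open Classical in
/-- If the vertices of `N` can be matched into the pieces of a decomposition, then
adding `N` does not increase `ρ`. -/
theorem union_le_of_matching (h : IsCoverFunction H ρ) {𝒟 : Finset (Finset V)}
    (h𝒟 : IsDecomposition H ρ 𝒟) {N : Finset V} (f : N → Finset V)
    (hf : Function.Injective f) (hf𝒟 : ∀ a, f a ∈ 𝒟) (hadj : ∀ a, ∃ z ∈ f a, H.Adj a z) :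
    ρ (𝒟.biUnion id ∪ N) ≤ ρ (𝒟.biUnion id) := by
  have hpiece : ∀ K ∈ 𝒟, ρ (K ∪ ({a | f a = K} : Finset N).image Subtype.val) ≤ ρ K := by
    intro K hK
    by_cases ha : ∃ a, f a = K
    · obtain ⟨a, rfl⟩ := ha
      obtain ⟨z, hz, haz⟩ := hadj a
      have : ({b | f b = f a} : Finset N) = {a} := by
        ext b
        simp [hf.eq_iff]
      rw [this, image_singleton, union_comm, ← insert_eq]
      exact h.insert_le_of_critical (h𝒟.critical _ hK) hz haz
    · have : ({b | f b = K} : Finset N) = ∅ := by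
        ext b
        simpa using fun e => ha ⟨b, e⟩
      rw [this, image_empty, union_empty]
  calc ρ (𝒟.biUnion id ∪ N)
      ≤ ρ (𝒟.biUnion fun K => K ∪ ({a | f a = K} : Finset N).image Subtype.val) := by
        refine h.mono (union_subset ?_ ?_)
        · exact biUnion_mono fun K _ => subset_union_left
        · intro a ha
          refine mem_biUnion.2 ⟨f ⟨a, ha⟩, hf𝒟 _, mem_union_right _ ?_⟩
          exact mem_image.2 ⟨⟨a, ha⟩, by simp, rfl⟩
    _ ≤ ∑ K ∈ 𝒟, ρ (K ∪ ({a | f a = K} : Finset N).image Subtype.val) :=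
        h.biUnion_le_sum _ _
    _ ≤ ∑ K ∈ 𝒟, ρ K := sum_le_sum hpiece
    _ ≤ _ := h.sum_le_biUnion h𝒟

open Classical in
/-- The vertices of `A` with a neighbour in a member of `𝒟`. -/
noncomputable def boundary (H : SimpleGraph V) (A : Finset V) (𝒟 : Finset (Finset V)) :
    Finset V :=
  {a ∈ A | ∃ K ∈ 𝒟, ∃ z ∈ K, H.Adj a z}

open Classical in
/-- If `|boundary 𝒟| ≤ |𝒟|`, some nonempty subfamily `ℰ` of `𝒟` has its boundary matched
into its members. -/
theorem exists_matching (A : Finset V) (𝒟 : Finset (Finset V)) (hne : 𝒟.Nonempty)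
    (hle : (boundary H A 𝒟).card ≤ 𝒟.card) :
    ∃ ℰ ⊆ 𝒟, ℰ.Nonempty ∧ ∃ f : boundary H A ℰ → Finset V, Function.Injective f ∧
      (∀ a, f a ∈ ℰ) ∧ ∀ a, ∃ z ∈ f a, H.Adj a z := by
  induction 𝒟 using Finset.strongInduction with
  | H 𝒟 ih =>
    by_cases hall : ∀ s : Finset (boundary H A 𝒟),
        s.card ≤ (s.biUnion fun a => {K ∈ 𝒟 | ∃ z ∈ K, H.Adj a z}).card
    · obtain ⟨f, hf, hmem⟩ :=
        (Finset.all_card_le_biUnion_card_iff_exists_injective _).1 hall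
      exact ⟨𝒟, Subset.rfl, hne, f, hf, fun a => (mem_filter.1 (hmem a)).1,
        fun a => (mem_filter.1 (hmem a)).2⟩
    · push Not at hall
      obtain ⟨s, hs⟩ := hall
      set ℬ := s.biUnion fun a => {K ∈ 𝒟 | ∃ z ∈ K, H.Adj a z} with hℬ
      have hℬ𝒟 : ℬ ⊆ 𝒟 := biUnion_subset.2 fun a _ => filter_subset _ _
      have hsub : boundary H A (𝒟 \ ℬ) ⊆ boundary H A 𝒟 \ s.image Subtype.val := by
        intro a ha
        obtain ⟨haA, K, hK, z, hz, haz⟩ := mem_filter.1 ha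
        obtain ⟨hK, hKℬ⟩ := mem_sdiff.1 hK
        refine mem_sdiff.2 ⟨mem_filter.2 ⟨haA, K, hK, z, hz, haz⟩, fun has => hKℬ ?_⟩
        obtain ⟨b, hb, rfl⟩ := mem_image.1 has
        exact mem_biUnion.2 ⟨b, hb, mem_filter.2 ⟨hK, z, hz, haz⟩⟩
      have hsA : s.image Subtype.val ⊆ boundary H A 𝒟 := by
        intro a ha
        obtain ⟨b, _, rfl⟩ := mem_image.1 ha
        exact b.2
      have h1 := card_le_card hsub
      rw [card_sdiff_of_subset hsA, card_image_of_injective _ Subtype.val_injective] at h1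
      have h2 := card_sdiff_of_subset hℬ𝒟
      have h3 := card_le_card hsA
      rw [card_image_of_injective _ Subtype.val_injective] at h3
      have hsne : s.Nonempty := card_pos.1 (by omega)
      have hss : 𝒟 \ ℬ ⊂ 𝒟 := by
        obtain ⟨a, ha⟩ := hsne
        obtain ⟨_, K, hK, hz⟩ := mem_filter.1 a.2
        refine (ssubset_iff_of_subset sdiff_subset).2 ⟨K, hK, fun hK' => ?_⟩
        exact (mem_sdiff.1 hK').2 (mem_biUnion.2 ⟨a, ha, mem_filter.2 ⟨hK, hz⟩⟩)
      obtain ⟨ℰ, hℰ, hrest⟩ := ih _ hss (card_pos.1 (by omega)) (by omega)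
      exact ⟨ℰ, hℰ.trans sdiff_subset, hrest⟩

open Classical in
theorem two_mul_le_of_inseparable_of_decomposition (h : IsCoverFunction H ρ) {X : Finset V}
    (hX : Critical ρ X) (hins : Inseparable H X)
    (hdec : ∀ D ⊂ X, Critical ρ D → ∃ 𝒟, IsDecomposition H ρ 𝒟 ∧ 𝒟.biUnion id = D) :
    2 * ρ X ≤ X.card + 1 := by
  by_contra! hlt
  have hXne : X.Nonempty := by
    rw [nonempty_iff_ne_empty]
    rintro rfl
    simp [h.map_empty] at hlt
  obtain ⟨v, hv⟩ := hXne
  obtain ⟨D, hDmem, hDmin⟩ := exists_min_image {D ∈ X.ssubsets | ρ X ≤ ρ D + 1} card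
    ⟨X.erase v, mem_filter.2 ⟨mem_ssubsets.2 (erase_ssubset hv), h.le_erase_add_one hv⟩⟩
  obtain ⟨hDX, hρD⟩ := mem_filter.1 hDmem
  rw [mem_ssubsets] at hDX
  have hDcrit : Critical ρ D := by
    intro z hz
    by_contra! hle
    have := hDmin (D.erase z) (mem_filter.2
      ⟨mem_ssubsets.2 ((erase_subset z D).trans_ssubset hDX), by omega⟩)
    have := card_erase_lt_of_mem hz
    omega
  obtain ⟨𝒟, h𝒟, h𝒟D⟩ := hdec D hDX hDcrit
  have hcard : X.card ≤ D.card + 𝒟.card := by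
    have h1 : ρ D ≤ ∑ K ∈ 𝒟, ρ K := by
      have := h.biUnion_le_sum 𝒟 id
      rwa [h𝒟D] at this
    have h2 : ∑ K ∈ 𝒟, 2 * ρ K ≤ ∑ K ∈ 𝒟, (K.card + 1) := sum_le_sum h𝒟.two_mul_le
    have h3 : D.card = ∑ K ∈ 𝒟, K.card := by
      rw [← h𝒟D]
      exact card_biUnion h𝒟.disjoint
    rw [← mul_sum, sum_add_distrib, ← h3, sum_const, smul_eq_mul, mul_one] at h2
    omega
  have hA := card_sdiff_of_subset hDX.subset
  have hlt' := card_lt_card hDX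
  have hb : (boundary H (X \ D) 𝒟).card ≤ (X \ D).card := card_le_card (filter_subset _ _)
  obtain ⟨ℰ, hℰ, ⟨K, hK⟩, f, hf, hfℰ, hfadj⟩ := exists_matching (H := H) (X \ D) 𝒟
    (card_pos.1 (by omega)) (by omega)
  have hℰD : ℰ.biUnion id ⊆ D := h𝒟D ▸ biUnion_subset_biUnion_of_subset_left _ hℰ
  have hadj : ∀ x ∈ ℰ.biUnion id, ∀ y ∈ X, y ∉ ℰ.biUnion id ∪ boundary H (X \ D) ℰ →
      ¬ H.Adj x y := by
    intro x hx y hy hyn hxy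
    rw [mem_union, not_or] at hyn
    obtain ⟨L, hL, hxL⟩ := mem_biUnion.1 hx
    by_cases hyD : y ∈ D
    · rw [← h𝒟D] at hyD
      obtain ⟨M, hM, hyM⟩ := mem_biUnion.1 hyD
      refine h𝒟.not_adj L (hℰ hL) M hM ?_ x hxL y hyM hxy
      rintro rfl
      exact hyn.1 (mem_biUnion.2 ⟨L, hL, hyM⟩)
    · exact hyn.2 (mem_filter.2 ⟨mem_sdiff.2 ⟨hy, hyD⟩, L, hL, x, hxL, hxy.symm⟩)
  have hbX : boundary H (X \ D) ℰ ⊆ X := (filter_subset _ _).trans sdiff_subset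
  have hbne : (boundary H (X \ D) ℰ).Nonempty := by
    obtain ⟨z, hz⟩ := h𝒟.nonempty K (hℰ hK)
    obtain ⟨x, hx, y, hy, hyn, hxy⟩ := hins (ℰ.biUnion id) (hℰD.trans hDX.subset)
      ⟨z, mem_biUnion.2 ⟨K, hK, hz⟩⟩ (fun e => hDX.2 (e ▸ hℰD))
    by_contra hemp
    rw [not_nonempty_iff_eq_empty] at hemp
    exact hadj x hx y hy (by rwa [hemp, union_empty]) hxy
  have h1 := h.lt_of_critical hX (hℰD.trans hDX.subset) hbX
    (disjoint_sdiff.mono hℰD (filter_subset _ _)) hbne hadj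
  have h2 := h.union_le_of_matching (h𝒟.subset hℰ) f hf hfℰ hfadj
  omega

open Classical in
theorem critical_left (h : IsCoverFunction H ρ) {Y Z : Finset V} (hX : Critical ρ (Y ∪ Z))
    (hd : Disjoint Y Z) (ha : ∀ y ∈ Y, ∀ z ∈ Z, ¬ H.Adj y z) : Critical ρ Y := by
  intro y hy
  have h1 := h.add_le (Y.erase y) Z (hd.mono_left (erase_subset _ _))
    (fun x hx => ha x (mem_of_mem_erase hx))
  have h2 := hX y (mem_union_left _ hy)
  rw [erase_union_distrib, erase_eq_of_notMem (disjoint_left.1 hd hy)] at h2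
  have h3 := h.union_le Y Z
  omega

open Classical in
theorem exists_decomposition (h : IsCoverFunction H ρ) (X : Finset V) (hX : Critical ρ X) :
    ∃ 𝒟, IsDecomposition H ρ 𝒟 ∧ 𝒟.biUnion id = X := by
  induction X using Finset.strongInduction with
  | H X ih =>
    by_cases hins : Inseparable H X
    · rcases X.eq_empty_or_nonempty with rfl | hne
      · exact ⟨∅, by constructor <;> simp, by simp⟩
      · refine ⟨{X}, ?_, by simp⟩
        have := h.two_mul_le_of_inseparable_of_decomposition hX hins ih
        constructor <;> simp_all
    · simp only [Inseparable] at hins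
      push Not at hins
      obtain ⟨Y, hYX, hYne, hYX', hadj⟩ := hins
      have hU : Y ∪ X \ Y = X := union_sdiff_of_subset hYX
      have ha : ∀ y ∈ Y, ∀ z ∈ X \ Y, ¬ H.Adj y z := fun y hy z hz =>
        hadj y hy z (mem_sdiff.1 hz).1 (mem_sdiff.1 hz).2
      have hY : Critical ρ Y := h.critical_left (hU.symm ▸ hX) disjoint_sdiff ha
      have hZ : Critical ρ (X \ Y) :=
        h.critical_left (Z := Y) (by rwa [union_comm, hU]) disjoint_sdiff.symm
          (fun z hz y hy e => ha y hy z hz e.symm)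
      obtain ⟨𝒟, h𝒟, h𝒟Y⟩ := ih Y (hYX.ssubset_of_ne hYX') hY
      obtain ⟨ℰ, hℰ, hℰZ⟩ := ih (X \ Y) (sdiff_ssubset hYX hYne) hZ
      refine ⟨𝒟 ∪ ℰ, h𝒟.union hℰ ?_ ?_, ?_⟩
      · rw [h𝒟Y, hℰZ]
        exact disjoint_sdiff
      · rwa [h𝒟Y, hℰZ]
      · rw [union_biUnion, h𝒟Y, hℰZ, hU]

theorem two_mul_le (h : IsCoverFunction H ρ) {X : Finset V} (hX : Critical ρ X)
    (hins : Inseparable H X) : 2 * ρ X ≤ X.card + 1 :=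
  h.two_mul_le_of_inseparable_of_decomposition hX hins fun D _ => h.exists_decomposition D

theorem inseparable_univ [Fintype V] (hH : H.Connected) : Inseparable H univ := by
  intro Y _ ⟨y, hy⟩ hYne
  obtain ⟨z, hz⟩ : ∃ z, z ∉ Y := by
    by_contra! hall
    exact hYne (eq_univ_iff_forall.2 hall)
  obtain ⟨p⟩ := hH.preconnected y z
  obtain ⟨d, _, h1, h2⟩ := p.exists_boundary_dart (Y : Set V) (by simpa) (by simpa)
  exact ⟨d.fst, by simpa using h1, d.snd, mem_univ _, by simpa using h2, d.adj⟩

end IsCoverFunction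

namespace BoundedCover

open Finset

variable {V : Type*}

/-- `P` consists of independent sets of `G` of size at most `k` and covers `X`. -/
def IsBoundedCover (G : SimpleGraph V) (k : ℕ) (X : Finset V) (P : Finset (Finset V)) : Prop :=
  (∀ s ∈ P, (∀ u ∈ s, ∀ v ∈ s, ¬ G.Adj u v) ∧ s.card ≤ k) ∧ ∀ v ∈ X, ∃ s ∈ P, v ∈ s

/-- Minimum size of a cover of `X` by independent sets of `G` of size at most `k`. -/
noncomputable def coverNumber (G : SimpleGraph V) (k : ℕ) (X : Finset V) : ℕ :=
  sInf {m | ∃ P, IsBoundedCover G k X P ∧ P.card = m}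

variable {G : SimpleGraph V} {k : ℕ} {X : Finset V} {P : Finset (Finset V)}

theorem coverNumber_le (hP : IsBoundedCover G k X P) : coverNumber G k X ≤ P.card :=
  Nat.sInf_le ⟨P, hP, rfl⟩

theorem exists_cover (G : SimpleGraph V) (hk : 1 ≤ k) (X : Finset V) :
    ∃ P, IsBoundedCover G k X P ∧ P.card = coverNumber G k X := by
  classical
  refine Nat.sInf_mem (s := {m | ∃ P, IsBoundedCover G k X P ∧ P.card = m}) ?_
  refine ⟨_, X.image singleton, ⟨?_, fun v hv => ⟨{v}, mem_image_of_mem _ hv, by simp⟩⟩, rfl⟩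
  intro s hs
  obtain ⟨v, _, rfl⟩ := mem_image.1 hs
  simpa using hk

theorem isCoverFunction (G : SimpleGraph V) (hk : 2 ≤ k) :
    IsCoverFunction Gᶜ (coverNumber G k) := by
  classical
  have hk1 : 1 ≤ k := by omega
  refine ⟨?_, ?_, ?_, ?_, ?_⟩
  · intro X Y hXY
    obtain ⟨P, hP, hc⟩ := exists_cover G hk1 Y
    exact hc ▸ coverNumber_le ⟨hP.1, fun v hv => hP.2 v (hXY hv)⟩
  · intro X Y
    obtain ⟨P, hP, hPc⟩ := exists_cover G hk1 X
    obtain ⟨Q, hQ, hQc⟩ := exists_cover G hk1 Y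
    rw [← hPc, ← hQc]
    convert (coverNumber_le (P := P ∪ Q) ⟨?_, ?_⟩).trans (card_union_le P Q)
    · exact fun s hs => (mem_union.1 hs).elim (hP.1 s) (hQ.1 s)
    · intro v hv
      rcases mem_union.1 hv with hv | hv
      · obtain ⟨s, hs, hvs⟩ := hP.2 v (by convert hv)
        exact ⟨s, mem_union_left _ hs, hvs⟩
      · obtain ⟨s, hs, hvs⟩ := hQ.2 v (by convert hv)
        exact ⟨s, mem_union_right _ hs, hvs⟩
  · intro X Y hd hXY
    obtain ⟨P, hP, hc⟩ := exists_cover G hk1 (X ∪ Y)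
    have hX : coverNumber G k X ≤ ({s ∈ P | ∃ x ∈ X, x ∈ s} : Finset _).card := by
      refine coverNumber_le ⟨fun s hs => hP.1 s (mem_filter.1 hs).1, fun v hv => ?_⟩
      obtain ⟨s, hs, hvs⟩ := hP.2 v (mem_union_left _ hv)
      exact ⟨s, mem_filter.2 ⟨hs, v, hv, hvs⟩, hvs⟩
    have hY : coverNumber G k Y ≤ ({s ∈ P | ∃ y ∈ Y, y ∈ s} : Finset _).card := by
      refine coverNumber_le ⟨fun s hs => hP.1 s (mem_filter.1 hs).1, fun v hv => ?_⟩
      obtain ⟨s, hs, hvs⟩ := hP.2 v (mem_union_right _ hv)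
      exact ⟨s, mem_filter.2 ⟨hs, v, hv, hvs⟩, hvs⟩
    have hdis : Disjoint ({s ∈ P | ∃ x ∈ X, x ∈ s} : Finset _)
        ({s ∈ P | ∃ y ∈ Y, y ∈ s} : Finset _) := by
      refine disjoint_left.2 fun s hs hs' => ?_
      obtain ⟨hsP, x, hx, hxs⟩ := mem_filter.1 hs
      obtain ⟨_, y, hy, hys⟩ := mem_filter.1 hs'
      refine hXY x hx y hy ((G.compl_adj x y).2 ⟨?_, (hP.1 s hsP).1 x hxs y hys⟩)
      rintro rfl
      exact disjoint_left.1 hd hx hy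
    have hu := card_le_card (union_subset (filter_subset (fun s => ∃ x ∈ X, x ∈ s) P)
      (filter_subset (fun s => ∃ y ∈ Y, y ∈ s) P))
    rw [card_union_of_disjoint hdis] at hu
    rw [← hc]
    omega
  · intro v
    refine coverNumber_le (P := {{v}}) ⟨?_, by simp⟩
    simpa using hk1
  · intro u v huv
    obtain ⟨_, hadj⟩ := (G.compl_adj u v).1 huv
    refine coverNumber_le (P := {{u, v}}) ⟨?_, by simp⟩
    have := (card_le_two (a := u) (b := v)).trans hk
    simp [hadj, G.adj_comm v u, this]

open Classical in
theorem boundedChromaticNumber_comap {W : Type*} [Fintype W] (G : SimpleGraph V) (f : W ↪ V)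
    (hk : 1 ≤ k) : boundedChromaticNumber (G.comap f) k = coverNumber G k (univ.map f) := by
  have key : ∃ P : Finset (Set W),
      ((∀ s ∈ P, (s.Pairwise fun u v => ¬ (G.comap f).Adj u v) ∧ s.ncard ≤ k) ∧
      (∀ v : W, ∃ s ∈ P, v ∈ s) ∧ (↑P : Set (Set W)).Pairwise Disjoint) ∧
      P.card ≤ coverNumber G k (univ.map f) := by
    obtain ⟨P, hP, hc⟩ := exists_cover G hk (univ.map f)
    choose c hcP hcm using fun w => hP.2 (f w) (mem_map_of_mem f (mem_univ w))
    refine ⟨P.image fun s => {w | c w = s}, ⟨?_, ?_, ?_⟩, hc ▸ card_image_le⟩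
    · intro t ht
      obtain ⟨s, hs, rfl⟩ := mem_image.1 ht
      constructor
      · intro u hu v hv _
        exact (hP.1 s hs).1 _ (hu ▸ hcm u) _ (hv ▸ hcm v)
      · refine le_trans ?_ (hP.1 s hs).2
        rw [← Set.ncard_coe_finset s, ← Set.ncard_image_of_injective _ f.injective]
        refine Set.ncard_le_ncard ?_ s.finite_toSet
        rintro _ ⟨w, hw, rfl⟩
        exact hw ▸ hcm w
    · exact fun w => ⟨_, mem_image_of_mem _ (hcP w), rfl⟩
    · intro a ha b hb hab
      obtain ⟨s, -, rfl⟩ := mem_image.1 (mem_coe.1 ha)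
      obtain ⟨t, -, rfl⟩ := mem_image.1 (mem_coe.1 hb)
      refine Set.disjoint_left.2 fun w hw hw' => hab ?_
      have hst : s = t := hw.symm.trans hw'
      rw [hst]
  refine le_antisymm ?_ ?_
  · obtain ⟨P, ⟨h1, h2, h3⟩, hle⟩ := key
    exact le_trans (Nat.sInf_le ⟨P, h1, h2, h3, rfl⟩) hle
  · obtain ⟨P₀, ⟨h1, h2, h3⟩, -⟩ := key
    obtain ⟨P, hP, hcov, -, hc⟩ := Nat.sInf_mem (s := {m : ℕ | ∃ P : Finset (Set W),
      (∀ s ∈ P, (s.Pairwise fun u v => ¬ (G.comap f).Adj u v) ∧ s.ncard ≤ k) ∧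
      (∀ v : W, ∃ s ∈ P, v ∈ s) ∧
      (↑P : Set (Set W)).Pairwise Disjoint ∧ P.card = m}) ⟨_, P₀, h1, h2, h3, rfl⟩
    rw [boundedChromaticNumber, ← hc]
    refine le_trans (coverNumber_le (P := P.image fun s => s.toFinset.map f) ⟨?_, ?_⟩)
      card_image_le
    · intro t ht
      obtain ⟨s, hs, rfl⟩ := mem_image.1 ht
      refine ⟨?_, ?_⟩
      · intro u hu v hv huv
        obtain ⟨a, ha, rfl⟩ := mem_map.1 hu
        obtain ⟨b, hb, rfl⟩ := mem_map.1 hv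
        exact (hP s hs).1 (Set.mem_toFinset.1 ha) (Set.mem_toFinset.1 hb)
          (fun e => huv.ne (congrArg f e)) huv
      · rw [card_map, ← Set.ncard_eq_toFinset_card']
        exact (hP s hs).2
    · intro v hv
      obtain ⟨w, -, rfl⟩ := mem_map.1 hv
      obtain ⟨s, hs, hws⟩ := hcov w
      exact ⟨_, mem_image_of_mem _ hs, mem_map_of_mem f (Set.mem_toFinset.2 hws)⟩

end BoundedCover

/-- If `k ≥ 2`, the complement of `G` is connected and
`χ_k(G - v) = χ_k(G) - 1` for every vertex `v`, then `2χ_k(G) ≤ n + 1`. -/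
theorem stmt_9 {V : Type*} [Fintype V] (G : SimpleGraph V) (k : ℕ) (hk : 2 ≤ k)
    (hConn : Gᶜ.Connected)
    (hCrit : ∀ v : V,
      boundedChromaticNumber (G.induce ({v}ᶜ : Set V)) k =
        boundedChromaticNumber G k - 1) :
    2 * boundedChromaticNumber G k ≤ Fintype.card V + 1 := by
  classical
  have hk1 : 1 ≤ k := by omega
  have hG : boundedChromaticNumber G k = BoundedCover.coverNumber G k Finset.univ := by
    refine (BoundedCover.boundedChromaticNumber_comap G
      (Function.Embedding.refl V) hk1).trans ?_
    rw [Finset.map_refl]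
  have hGv : ∀ v : V, boundedChromaticNumber (G.induce ({v}ᶜ : Set V)) k =
      BoundedCover.coverNumber G k (Finset.univ.erase v) := by
    intro v
    refine (BoundedCover.boundedChromaticNumber_comap G
      (Function.Embedding.subtype (· ∈ ({v}ᶜ : Set V))) hk1).trans ?_
    congr 1
    ext w
    simp
  rcases Nat.eq_zero_or_pos (boundedChromaticNumber G k) with h0 | hpos
  · omega
  · rw [hG] at hpos ⊢
    refine (BoundedCover.isCoverFunction G hk).two_mul_le ?_
      (IsCoverFunction.inseparable_univ hConn)
    intro v _
    have := hCrit v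
    rw [hG, hGv] at this
    convert (show BoundedCover.coverNumber G k (Finset.univ.erase v) <
      BoundedCover.coverNumber G k Finset.univ by omega)
end

section
/- Let D = (V, r) be a finite digraph without loops (r : V → V → Prop irreflexive) on n vertices, and let a(D) denote the minimum number of parts in a partition of V into sets each inducing an acyclic subdigraph. Let G₂ be the simple graph on V in which distinct u, v are adjacent exactly when not both r u v and r v u hold. If G₂ is connected and a(D − v) = a(D) − 1 for every vertex v ∈ V, then 2·a(D) ≤ n + 1. -/
/-- A set `s` of vertices induces an acyclic subdigraph of the digraph with arc
relation `r`: the transitive closure of `r` restricted to `s` is irreflexive. -/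
def InducesAcyclic {V : Type*} (r : V → V → Prop) (s : Set V) : Prop :=
  ∀ x : V, ¬ Relation.TransGen (fun a b => a ∈ s ∧ b ∈ s ∧ r a b) x x

/-- The dichromatic number of the digraph with arc relation `r`, restricted to
the vertex set `S`: the minimum number of parts in a partition of `S` into sets
each inducing an acyclic subdigraph. For `S = Finset.univ` this is `a(D)`; for
`S = Finset.univ.erase v` this is `a(D - v)`. -/
noncomputable def dichromaticOn {V : Type*} (r : V → V → Prop) (S : Finset V) : ℕ :=
  sInf {m : ℕ | ∃ P : Finset (Set V),
    (∀ s ∈ P, s ⊆ ↑S ∧ InducesAcyclic r s) ∧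
    (∀ v ∈ S, ∃ s ∈ P, v ∈ s) ∧
    (↑P : Set (Set V)).Pairwise Disjoint ∧ P.card = m}

/-- Two finite vertex sets are separated in `H` if they are disjoint and no edge of `H` joins
them. -/
def Separated {V : Type*} (H : SimpleGraph V) (S T : Finset V) : Prop :=
  ∀ x ∈ S, ∀ y ∈ T, x ≠ y ∧ ¬ H.Adj x y

/-- The properties of a chromatic-type invariant `χ` of vertex sets that drive Gallai's bound:
it is monotone and subadditive, additive on separated sets, and at most one on vertices and
edges of `H`. -/
structure IsChromaticFor {V : Type*} [DecidableEq V] (H : SimpleGraph V) (χ : Finset V → ℕ) :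
    Prop where
  empty : χ ∅ = 0
  mono : ∀ S T : Finset V, S ⊆ T → χ S ≤ χ T
  union_le : ∀ S T : Finset V, χ (S ∪ T) ≤ χ S + χ T
  le_union : ∀ S T : Finset V, Separated H S T → χ S + χ T ≤ χ (S ∪ T)
  singleton : ∀ x, χ {x} ≤ 1
  pair : ∀ x y, H.Adj x y → χ {x, y} ≤ 1

/-- Deleting any vertex of `S` decreases `χ`. -/
def IsCritical {V : Type*} [DecidableEq V] (χ : Finset V → ℕ) (S : Finset V) : Prop :=
  ∀ x ∈ S, χ (S.erase x) < χ S

/-- `S` cannot be split into two nonempty separated sets. -/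
def IsUnsplit {V : Type*} [DecidableEq V] (H : SimpleGraph V) (S : Finset V) : Prop :=
  ∀ T ⊆ S, T.Nonempty → Separated H T (S \ T) → T = S

/-- A partition of `S` into nonempty, critical, pairwise separated sets. -/
structure IsCriticalPartition {V : Type*} [DecidableEq V] (H : SimpleGraph V)
    (χ : Finset V → ℕ) (S : Finset V) (F : Finset (Finset V)) : Prop where
  nonempty : ∀ P ∈ F, P.Nonempty
  critical : ∀ P ∈ F, IsCritical χ P
  separated : ∀ P ∈ F, ∀ Q ∈ F, P ≠ Q → Separated H P Q
  biUnion_eq : F.biUnion id = S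

namespace IsChromaticFor

variable {V : Type*} [DecidableEq V] {H : SimpleGraph V} {χ : Finset V → ℕ}

theorem biUnion_le (h : IsChromaticFor H χ) {ι : Type*} [DecidableEq ι] (Z : Finset ι)
    (f : ι → Finset V) : χ (Z.biUnion f) ≤ ∑ i ∈ Z, χ (f i) := by
  induction Z using Finset.induction_on with
  | empty => simp [h.empty]
  | insert a s ha ih =>
    rw [Finset.biUnion_insert, Finset.sum_insert ha]
    exact (h.union_le _ _).trans (by lia)

theorem sum_le_biUnion (h : IsChromaticFor H χ) (Z : Finset (Finset V))
    (hZ : ∀ P ∈ Z, ∀ Q ∈ Z, P ≠ Q → Separated H P Q) : ∑ P ∈ Z, χ P ≤ χ (Z.biUnion id) := by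
  induction Z using Finset.induction_on with
  | empty => simp
  | insert a s ha ih =>
    rw [Finset.biUnion_insert, Finset.sum_insert ha]
    have h1 := ih fun P hP Q hQ =>
      hZ P (Finset.mem_insert_of_mem hP) Q (Finset.mem_insert_of_mem hQ)
    have h2 : Separated H (id a) (s.biUnion id) := by
      intro x hx y hy
      obtain ⟨Q, hQ, hyQ⟩ := Finset.mem_biUnion.1 hy
      exact hZ a (Finset.mem_insert_self _ _) Q (Finset.mem_insert_of_mem hQ)
        (fun e => ha (e ▸ hQ)) x hx y hyQ
    have h3 := h.le_union _ _ h2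
    simp only [id] at h3 ⊢
    lia

/-- A vertex with a neighbour in a critical set can be added without increasing `χ`. -/
theorem insert_le_of_adj (h : IsChromaticFor H χ) {P : Finset V} (hP : IsCritical χ P) {x y : V}
    (hx : x ∈ P) (hxy : H.Adj x y) : χ (insert y P) ≤ χ P := by
  have h1 : insert y P = P.erase x ∪ {x, y} := by
    ext z
    by_cases hz : z = x <;> simp [hz, hx]
  have h2 := h.union_le (P.erase x) {x, y}
  have h3 := h.pair x y hxy
  have h4 := hP x hx
  rw [h1]
  lia

theorem critical_left (h : IsChromaticFor H χ) {S T : Finset V} (hST : Separated H S T)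
    (hc : IsCritical χ (S ∪ T)) : IsCritical χ S := by
  intro x hx
  have hxT : x ∉ T := fun hT => (hST x hx x hT).1 rfl
  have h1 := hc x (Finset.mem_union_left _ hx)
  have h2 : (S ∪ T).erase x = S.erase x ∪ T := by
    rw [Finset.erase_union_distrib, Finset.erase_eq_of_notMem hxT]
  have h3 := h.le_union (S.erase x) T fun a ha b hb => hST a (Finset.mem_of_mem_erase ha) b hb
  have h4 := h.union_le S T
  rw [h2] at h1
  lia

theorem exists_isCritical_subset (χ : Finset V → ℕ) (S : Finset V) (k : ℕ) (hk : k ≤ χ S) :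
    ∃ U ⊆ S, IsCritical χ U ∧ k ≤ χ U := by
  obtain ⟨U, hU, hmin⟩ := Finset.exists_min_image (S.powerset.filter fun U => k ≤ χ U)
    Finset.card ⟨S, by simp [hk]⟩
  simp only [Finset.mem_filter, Finset.mem_powerset] at hU hmin
  refine ⟨U, hU.1, fun x hx => ?_, hU.2⟩
  by_contra! hle
  have h1 := hmin (U.erase x) ⟨(Finset.erase_subset _ _).trans hU.1, hU.2.trans hle⟩
  have h2 := Finset.card_erase_lt_of_mem hx
  lia

/-- If every neighbour outside `⋃ Z` is matched to a part of `Z` adjacent to it, then adding the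
matched vertices to `⋃ Z` does not increase `χ`. -/
theorem biUnion_union_le_of_matching (h : IsChromaticFor H χ) (Z : Finset (Finset V))
    (hcrit : ∀ P ∈ Z, IsCritical χ P)
    (hsep : ∀ P ∈ Z, ∀ Q ∈ Z, P ≠ Q → Separated H P Q) (I : Finset V)
    (m : I → Finset V) (hm : Function.Injective m)
    (hmZ : ∀ a, m a ∈ Z ∧ ∃ x ∈ m a, H.Adj x a) :
    χ (Z.biUnion id ∪ I) ≤ χ (Z.biUnion id) := by
  classical
  let E : Finset V → Finset V := fun P => P ∪ (I.attach.filter fun a => m a = P).image Subtype.val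
  have hE : ∀ P ∈ Z, χ (E P) ≤ χ P := by
    intro P hP
    by_cases hex : ∃ a, m a = P
    · obtain ⟨a, rfl⟩ := hex
      obtain ⟨x, hx, hxa⟩ := (hmZ a).2
      refine (h.mono _ (insert a.1 (m a)) ?_).trans (h.insert_le_of_adj (hcrit _ hP) hx hxa)
      intro z hz
      simp only [E, Finset.mem_union, Finset.mem_image, Finset.mem_filter] at hz
      rcases hz with hz | ⟨b, ⟨-, hb⟩, rfl⟩
      · exact Finset.mem_insert_of_mem hz
      · rw [hm hb]
        exact Finset.mem_insert_self _ _
    · refine h.mono _ _ fun z hz => ?_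
      simp only [E, Finset.mem_union, Finset.mem_image, Finset.mem_filter] at hz
      rcases hz with hz | ⟨b, ⟨-, hb⟩, rfl⟩
      · exact hz
      · exact absurd ⟨b, hb⟩ hex
  have hsub : Z.biUnion id ∪ I ⊆ Z.biUnion E := by
    intro z hz
    rcases Finset.mem_union.1 hz with hz | hz
    · obtain ⟨P, hP, hzP⟩ := Finset.mem_biUnion.1 hz
      exact Finset.mem_biUnion.2 ⟨P, hP, Finset.mem_union_left _ hzP⟩
    · refine Finset.mem_biUnion.2 ⟨m ⟨z, hz⟩, (hmZ _).1, Finset.mem_union_right _ ?_⟩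
      exact Finset.mem_image.2 ⟨⟨z, hz⟩, by simp, rfl⟩
  calc χ (Z.biUnion id ∪ I) ≤ χ (Z.biUnion E) := h.mono _ _ hsub
    _ ≤ ∑ P ∈ Z, χ (E P) := h.biUnion_le _ _
    _ ≤ ∑ P ∈ Z, χ P := Finset.sum_le_sum hE
    _ ≤ χ (Z.biUnion id) := h.sum_le_biUnion Z hsep

end IsChromaticFor

/-- If a relation does not have more right vertices than left vertices, then some nonempty set of
left vertices has its right neighbourhood matched into it. -/
theorem exists_nonempty_matched_neighborhood {α β : Type*} [DecidableEq α] [DecidableEq β]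
    (F : Finset α) (R : Finset β) (adj : α → β → Prop) (hF : F.Nonempty) (hcard : R.card ≤ F.card) :
    ∃ Z ⊆ F, Z.Nonempty ∧ ∃ I ⊆ R, (∀ b ∈ R, b ∈ I ↔ ∃ a ∈ Z, adj a b) ∧
      ∃ m : I → α, Function.Injective m ∧ ∀ b, m b ∈ Z ∧ adj (m b) b := by
  classical
  let N : Finset α → Finset β := fun Z => R.filter fun b => ∃ a ∈ Z, adj a b
  obtain ⟨Z, hZ, hmin⟩ := Finset.exists_min_image
    (F.powerset.filter fun Z => Z.Nonempty ∧ (N Z).card ≤ Z.card) Finset.card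
    ⟨F, by
      simp only [Finset.mem_filter, Finset.mem_powerset]
      exact ⟨subset_rfl, hF, (Finset.card_le_card (Finset.filter_subset _ _)).trans hcard⟩⟩
  simp only [Finset.mem_filter, Finset.mem_powerset] at hZ hmin
  obtain ⟨hZF, hZne, hZN⟩ := hZ
  refine ⟨Z, hZF, hZne, N Z, Finset.filter_subset _ _, fun b hb => by simp [N, hb], ?_⟩
  let t : N Z → Finset α := fun b => Z.filter fun a => adj a b
  suffices ht : ∀ s : Finset (N Z), s.card ≤ (s.biUnion t).card by
    obtain ⟨m, hm, hmt⟩ := (Finset.all_card_le_biUnion_card_iff_exists_injective t).1 ht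
    exact ⟨m, hm, fun b => Finset.mem_filter.1 (hmt b)⟩
  intro s
  by_contra! hs
  have hsub : s.biUnion t ⊆ Z := Finset.biUnion_subset.2 fun b _ => Finset.filter_subset _ _
  have hX : s.image Subtype.val ⊆ N Z := by
    intro b hb
    obtain ⟨c, -, rfl⟩ := Finset.mem_image.1 hb
    exact c.2
  have hXc : (s.image Subtype.val).card = s.card :=
    Finset.card_image_of_injective _ Subtype.val_injective
  have hN : N (Z \ s.biUnion t) ⊆ N Z \ s.image Subtype.val := by
    intro b hb
    obtain ⟨hbR, a, ha, hab⟩ := Finset.mem_filter.1 hb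
    obtain ⟨haZ, hat⟩ := Finset.mem_sdiff.1 ha
    refine Finset.mem_sdiff.2 ⟨Finset.mem_filter.2 ⟨hbR, a, haZ, hab⟩, fun hbs => hat ?_⟩
    obtain ⟨c, hc, rfl⟩ := Finset.mem_image.1 hbs
    exact Finset.mem_biUnion.2 ⟨c, hc, Finset.mem_filter.2 ⟨haZ, hab⟩⟩
  have h1 := Finset.card_le_card hN
  have h2 := Finset.card_sdiff_add_card_eq_card hX
  have h3 := Finset.card_sdiff_add_card_eq_card hsub
  have hne : (Z \ s.biUnion t).Nonempty := Finset.card_pos.1 (by lia)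
  have h4 := hmin _ ⟨Finset.sdiff_subset.trans hZF, hne, by lia⟩
  have h5 : (s.biUnion t).Nonempty := by
    obtain ⟨b, hb⟩ : s.Nonempty := Finset.card_pos.1 (by lia)
    obtain ⟨-, a, ha, hab⟩ := Finset.mem_filter.1 b.2
    exact ⟨a, Finset.mem_biUnion.2 ⟨b, hb, Finset.mem_filter.2 ⟨ha, hab⟩⟩⟩
  have h6 := h5.card_pos
  lia

namespace IsChromaticFor

variable {V : Type*} [DecidableEq V] {H : SimpleGraph V} {χ : Finset V → ℕ}

/-- In an unsplit critical set, the parts of a critical partition of a proper subset are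
outnumbered by the remaining vertices. -/
theorem card_partition_lt (h : IsChromaticFor H χ) {S U : Finset V} (hS : IsCritical χ S)
    (hconn : IsUnsplit H S) (hUS : U ⊂ S) {F : Finset (Finset V)}
    (hF : IsCriticalPartition H χ U F) : F.card < (S \ U).card := by
  classical
  by_contra! hcard
  obtain ⟨v, hvS, hvU⟩ := Finset.exists_of_ssubset hUS
  have hRpos : 0 < (S \ U).card := Finset.card_pos.2 ⟨v, Finset.mem_sdiff.2 ⟨hvS, hvU⟩⟩
  obtain ⟨Z, hZF, ⟨P₀, hP₀⟩, I, hIR, hI, m, hm, hmZ⟩ := exists_nonempty_matched_neighborhood F (S \ U)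
    (fun P b => ∃ x ∈ P, H.Adj x b) (Finset.card_pos.1 (by lia)) hcard
  have hOU : Z.biUnion id ⊆ U := by
    rw [← hF.biUnion_eq]
    exact Finset.biUnion_subset_biUnion_of_subset_left _ hZF
  have hkey := h.biUnion_union_le_of_matching Z (fun P hP => hF.critical P (hZF hP))
    (fun P hP Q hQ => hF.separated P (hZF hP) Q (hZF hQ)) I m hm hmZ
  set O := Z.biUnion id with hO
  have hsep : Separated H O (S \ (O ∪ I)) := by
    intro x hx y hy
    simp only [Finset.mem_sdiff, Finset.mem_union, not_or] at hy
    obtain ⟨hyS, hyO, hyI⟩ := hy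
    obtain ⟨P, hP, hxP⟩ := Finset.mem_biUnion.1 hx
    by_cases hyU : y ∈ U
    · rw [← hF.biUnion_eq] at hyU
      obtain ⟨Q, hQ, hyQ⟩ := Finset.mem_biUnion.1 hyU
      refine hF.separated P (hZF hP) Q hQ ?_ x hxP y hyQ
      rintro rfl
      exact hyO (Finset.mem_biUnion.2 ⟨P, hP, hyQ⟩)
    · refine ⟨fun e => hyO (e ▸ hx), fun hadj => hyI ?_⟩
      exact (hI y (Finset.mem_sdiff.2 ⟨hyS, hyU⟩)).2 ⟨P, hP, x, hxP, hadj⟩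
  have hle : χ S ≤ χ (O ∪ (S \ (O ∪ I))) := by
    have h1 := h.union_le (O ∪ I) (S \ (O ∪ I))
    have h2 := h.le_union _ _ hsep
    have h3 := h.mono S ((O ∪ I) ∪ (S \ (O ∪ I)))
      (by rw [Finset.union_sdiff_self_eq_union]; exact Finset.subset_union_right)
    lia
  have hIe : I = ∅ := by
    refine Finset.eq_empty_of_forall_notMem fun a ha => ?_
    obtain ⟨haS, haU⟩ := Finset.mem_sdiff.1 (hIR ha)
    have h1 := hS a haS
    have h2 := h.mono (O ∪ (S \ (O ∪ I))) (S.erase a) (by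
      intro z hz
      simp only [Finset.mem_union, Finset.mem_sdiff, not_or] at hz
      refine Finset.mem_erase.2 ⟨?_, ?_⟩
      · rintro rfl
        rcases hz with hz | hz
        · exact haU (hOU hz)
        · exact hz.2.2 ha
      · exact hz.elim (fun hz => hUS.1 (hOU hz)) fun hz => hz.1)
    lia
  rw [hIe, Finset.union_empty] at hsep
  obtain ⟨x, hx⟩ := hF.nonempty P₀ (hZF hP₀)
  have hOS := hconn O (hOU.trans hUS.1) ⟨x, Finset.mem_biUnion.2 ⟨P₀, hP₀, hx⟩⟩ hsep
  exact hvU (hOU (hOS ▸ hvS))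

theorem two_mul_le_of_isUnsplit (h : IsChromaticFor H χ) {S : Finset V} (hS : IsCritical χ S)
    (hconn : IsUnsplit H S) (hne : S.Nonempty)
    (hpart : ∀ U ⊂ S, IsCritical χ U →
      ∃ F, IsCriticalPartition H χ U F ∧ 2 * χ U ≤ U.card + F.card) :
    2 * χ S ≤ S.card + 1 := by
  obtain ⟨v, hv⟩ := hne
  have h1 := h.union_le (S.erase v) {v}
  have h2 : S.erase v ∪ {v} = S := by
    rw [Finset.union_comm, ← Finset.insert_eq, Finset.insert_erase hv]
  have h3 := h.singleton v
  rw [h2] at h1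
  obtain ⟨U, hUS, hU, hk⟩ := exists_isCritical_subset χ (S.erase v) (χ S - 1) (by lia)
  have hss : U ⊂ S := lt_of_le_of_lt hUS (Finset.erase_ssubset hv)
  obtain ⟨F, hF, hle⟩ := hpart U hss hU
  have h4 := h.card_partition_lt hS hconn hss hF
  have h5 := Finset.card_sdiff_add_card_eq_card hss.1
  lia

theorem exists_criticalPartition (h : IsChromaticFor H χ) (S : Finset V) (hS : IsCritical χ S) :
    ∃ F, IsCriticalPartition H χ S F ∧ 2 * χ S ≤ S.card + F.card := by
  classical
  induction S using Finset.strongInduction with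
  | H S ih =>
  rcases S.eq_empty_or_nonempty with rfl | hne
  · exact ⟨∅, ⟨by simp, by simp, by simp, by simp⟩, by simp [h.empty]⟩
  by_cases hconn : IsUnsplit H S
  · refine ⟨{S}, ⟨by simpa using hne, by simpa using hS, by simp, by simp⟩, ?_⟩
    simpa using h.two_mul_le_of_isUnsplit hS hconn hne ih
  · unfold IsUnsplit at hconn
    push Not at hconn
    obtain ⟨T, hTS, hTne, hsep, hTneq⟩ := hconn
    have hunion : T ∪ (S \ T) = S := Finset.union_sdiff_of_subset hTS
    have hsep' : Separated H (S \ T) T := fun x hx y hy =>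
      ⟨(hsep y hy x hx).1.symm, fun hadj => (hsep y hy x hx).2 hadj.symm⟩
    have hT : IsCritical χ T := h.critical_left hsep (by rwa [hunion])
    have hT' : IsCritical χ (S \ T) :=
      h.critical_left hsep' (by rwa [Finset.union_comm, hunion])
    obtain ⟨F, hF, hle⟩ := ih T (hTS.ssubset_of_ne hTneq) hT
    obtain ⟨F', hF', hle'⟩ := ih (S \ T) (Finset.sdiff_ssubset hTS hTne) hT'
    have hsub : ∀ P ∈ F, P ⊆ T := fun P hP => by
      rw [← hF.biUnion_eq]
      exact Finset.subset_biUnion_of_mem id hP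
    have hsub' : ∀ P ∈ F', P ⊆ S \ T := fun P hP => by
      rw [← hF'.biUnion_eq]
      exact Finset.subset_biUnion_of_mem id hP
    have hdisj : Disjoint F F' := by
      refine Finset.disjoint_left.2 fun P hP hP' => ?_
      obtain ⟨x, hx⟩ := hF.nonempty P hP
      exact (Finset.mem_sdiff.1 (hsub' P hP' hx)).2 (hsub P hP hx)
    refine ⟨F ∪ F', ⟨?_, ?_, ?_, ?_⟩, ?_⟩
    · intro P hP
      exact (Finset.mem_union.1 hP).elim (hF.nonempty P) (hF'.nonempty P)
    · intro P hP
      exact (Finset.mem_union.1 hP).elim (hF.critical P) (hF'.critical P)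
    · intro P hP Q hQ hPQ
      rcases Finset.mem_union.1 hP with hP | hP <;> rcases Finset.mem_union.1 hQ with hQ | hQ
      · exact hF.separated P hP Q hQ hPQ
      · exact fun x hx y hy => hsep x (hsub P hP hx) y (hsub' Q hQ hy)
      · exact fun x hx y hy => hsep' x (hsub' P hP hx) y (hsub Q hQ hy)
      · exact hF'.separated P hP Q hQ hPQ
    · rw [Finset.union_biUnion, hF.biUnion_eq, hF'.biUnion_eq, hunion]
    · have h1 := h.union_le T (S \ T)
      have h2 := Finset.card_sdiff_add_card_eq_card hTS
      rw [hunion] at h1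
      rw [Finset.card_union_of_disjoint hdisj]
      lia

end IsChromaticFor

theorem InducesAcyclic.mono {V : Type*} {r : V → V → Prop} {s t : Set V}
    (ht : InducesAcyclic r t) (hst : s ⊆ t) : InducesAcyclic r s := fun x hx =>
  ht x (Relation.TransGen.mono (fun _ _ hab => ⟨hst hab.1, hst hab.2.1, hab.2.2⟩) _ _ hx)

theorem InducesAcyclic.of_rank {V : Type*} {r : V → V → Prop} {s : Set V} (g : V → ℕ)
    (hg : ∀ a ∈ s, ∀ b ∈ s, r a b → g a < g b) : InducesAcyclic r s := by
  intro x hx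
  have key : ∀ y, Relation.TransGen (fun a b => a ∈ s ∧ b ∈ s ∧ r a b) x y → g x < g y := by
    intro y hy
    induction hy with
    | single hab => exact hg _ hab.1 _ hab.2.1 hab.2.2
    | tail _ hab ih => exact ih.trans (hg _ hab.1 _ hab.2.1 hab.2.2)
  exact lt_irrefl _ (key x hx)

section dichromatic

variable {V : Type*} {r : V → V → Prop}

/-- A colouring of the vertices of `S` all of whose classes are acyclic. -/
def IsAcyclicColoring (r : V → V → Prop) (S : Finset V) (c : V → ℕ) : Prop :=
  ∀ i, InducesAcyclic r {v | v ∈ S ∧ c v = i}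

theorem IsAcyclicColoring.mono {S T : Finset V} {c : V → ℕ} (hc : IsAcyclicColoring r T c)
    (hST : S ⊆ T) : IsAcyclicColoring r S c := fun i =>
  (hc i).mono fun _ hv => ⟨hST hv.1, hv.2⟩

theorem IsAcyclicColoring.exists_partition {S : Finset V} {c : V → ℕ}
    (hc : IsAcyclicColoring r S c) : ∃ P : Finset (Set V),
      (∀ s ∈ P, s ⊆ ↑S ∧ InducesAcyclic r s) ∧ (∀ v ∈ S, ∃ s ∈ P, v ∈ s) ∧
      (↑P : Set (Set V)).Pairwise Disjoint ∧ P.card ≤ (S.image c).card := by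
  classical
  refine ⟨(S.image c).image fun i => {v | v ∈ S ∧ c v = i}, ?_, ?_, ?_, Finset.card_image_le⟩
  · intro s hs
    obtain ⟨i, -, rfl⟩ := Finset.mem_image.1 hs
    exact ⟨fun v hv => hv.1, hc i⟩
  · intro v hv
    exact ⟨_, Finset.mem_image_of_mem _ (Finset.mem_image_of_mem c hv), hv, rfl⟩
  · intro s hs t ht hst
    obtain ⟨i, -, rfl⟩ := Finset.mem_image.1 (Finset.mem_coe.1 hs)
    obtain ⟨j, -, rfl⟩ := Finset.mem_image.1 (Finset.mem_coe.1 ht)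
    refine Set.disjoint_left.2 fun v hv hv' => hst ?_
    rw [← hv.2, ← hv'.2]

theorem IsAcyclicColoring.dichromaticOn_le {S : Finset V} {c : V → ℕ}
    (hc : IsAcyclicColoring r S c) : dichromaticOn r S ≤ (S.image c).card := by
  obtain ⟨P, h1, h2, h3, h4⟩ := hc.exists_partition
  have hle : dichromaticOn r S ≤ P.card := Nat.sInf_le ⟨P, h1, h2, h3, rfl⟩
  exact hle.trans h4

theorem exists_isAcyclicColoring [Fintype V] (hirr : ∀ x, ¬ r x x) (S : Finset V) :
    ∃ c : V → ℕ, IsAcyclicColoring r S c ∧ ∀ v ∈ S, c v < dichromaticOn r S := by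
  classical
  have hc₀ : IsAcyclicColoring r S fun v => (Fintype.equivFin V v : ℕ) := by
    intro i
    refine InducesAcyclic.of_rank (fun _ => 0) fun a ha b hb hab => ?_
    have : a = b := (Fintype.equivFin V).injective (Fin.ext (ha.2.trans hb.2.symm))
    exact absurd (this ▸ hab) (hirr b)
  obtain ⟨P₀, h1, h2, h3, -⟩ := hc₀.exists_partition
  obtain ⟨P, hP, hcov, -, hcard⟩ := Nat.sInf_mem (s := {m : ℕ | ∃ P : Finset (Set V),
    (∀ s ∈ P, s ⊆ ↑S ∧ InducesAcyclic r s) ∧ (∀ v ∈ S, ∃ s ∈ P, v ∈ s) ∧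
    (↑P : Set (Set V)).Pairwise Disjoint ∧ P.card = m}) ⟨_, P₀, h1, h2, h3, rfl⟩
  choose! p hpP hpv using hcov
  refine ⟨fun v => if h : p v ∈ P then (P.equivFin ⟨p v, h⟩ : ℕ) else 0, ?_, ?_⟩
  · intro i x hx
    by_cases hne : ∃ w ∈ S, (if h : p w ∈ P then (P.equivFin ⟨p w, h⟩ : ℕ) else 0) = i
    · obtain ⟨w, hw, hwi⟩ := hne
      refine (hP (p w) (hpP w hw)).2.mono ?_ x hx
      rintro v ⟨hv, hvi⟩
      beta_reduce at hvi
      rw [dif_pos (hpP v hv)] at hvi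
      rw [dif_pos (hpP w hw)] at hwi
      have := P.equivFin.injective (Fin.ext (hvi.trans hwi.symm))
      rw [← Subtype.mk.inj this]
      exact hpv v hv
    · refine InducesAcyclic.of_rank (fun _ => 0) (fun a ha => ?_) x hx
      exact absurd ⟨a, ha.1, ha.2⟩ hne
  · intro v hv
    simp only [hpP v hv, dif_pos]
    exact (Fin.is_lt _).trans_eq hcard

theorem isChromaticFor_dichromaticOn [Fintype V] [DecidableEq V] (hirr : ∀ x, ¬ r x x) (H : SimpleGraph V)
    (hH : ∀ u v : V, H.Adj u v ↔ u ≠ v ∧ ¬ (r u v ∧ r v u)) :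
    IsChromaticFor H (dichromaticOn r) where
  empty := by
    have hc : IsAcyclicColoring r ∅ fun _ => 0 := fun i =>
      InducesAcyclic.of_rank (fun _ => 0) fun a ha => absurd ha.1 (Finset.notMem_empty a)
    simpa using hc.dichromaticOn_le
  mono S T hST := by
    obtain ⟨c, hc, hlt⟩ := exists_isAcyclicColoring hirr T
    refine (hc.mono hST).dichromaticOn_le.trans ?_
    rw [← Finset.card_range (dichromaticOn r T)]
    refine Finset.card_le_card (Finset.image_subset_iff.2 fun v hv => ?_)
    exact Finset.mem_range.2 (hlt v (hST hv))
  union_le S T := by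
    obtain ⟨c, hc, hlt⟩ := exists_isAcyclicColoring hirr S
    obtain ⟨d, hd, hlt'⟩ := exists_isAcyclicColoring hirr T
    have he : IsAcyclicColoring r (S ∪ T)
        fun v => if v ∈ S then c v else dichromaticOn r S + d v := by
      intro i
      by_cases hi : i < dichromaticOn r S
      · refine (hc i).mono ?_
        rintro v ⟨hv, hvi⟩
        by_cases hvS : v ∈ S
        · exact ⟨hvS, by simpa [hvS] using hvi⟩
        · simp only [hvS, if_false] at hvi
          lia
      · refine (hd (i - dichromaticOn r S)).mono ?_
        rintro v ⟨hv, hvi⟩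
        by_cases hvS : v ∈ S
        · simp only [hvS, if_true] at hvi
          exact absurd (hvi ▸ hlt v hvS) hi
        · simp only [hvS, if_false] at hvi
          exact ⟨(Finset.mem_union.1 hv).resolve_left hvS, by lia⟩
    refine he.dichromaticOn_le.trans ?_
    rw [← Finset.card_range (dichromaticOn r S + dichromaticOn r T)]
    refine Finset.card_le_card (Finset.image_subset_iff.2 fun v hv => Finset.mem_range.2 ?_)
    by_cases hvS : v ∈ S
    · have := hlt v hvS
      simp only [hvS, if_true]
      lia
    · have := hlt' v ((Finset.mem_union.1 hv).resolve_left hvS)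
      simp only [hvS, if_false]
      lia
  le_union S T hST := by
    obtain ⟨c, hc, hlt⟩ := exists_isAcyclicColoring hirr (S ∪ T)
    have h1 := (hc.mono Finset.subset_union_left).dichromaticOn_le
    have h2 := (hc.mono Finset.subset_union_right).dichromaticOn_le
    have hdisj : Disjoint (S.image c) (T.image c) := by
      refine Finset.disjoint_left.2 fun i hi hi' => ?_
      obtain ⟨x, hx, rfl⟩ := Finset.mem_image.1 hi
      obtain ⟨y, hy, hyx⟩ := Finset.mem_image.1 hi'
      obtain ⟨hne, hadj⟩ := hST x hx y hy
      rw [hH, not_and, not_not] at hadj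
      obtain ⟨hxy, hyx'⟩ := hadj hne
      have hx' := Finset.mem_union_left T hx
      have hy' := Finset.mem_union_right S hy
      exact hc (c x) x (.tail (.single ⟨⟨hx', rfl⟩, ⟨hy', hyx⟩, hxy⟩)
        ⟨⟨hy', hyx⟩, ⟨hx', rfl⟩, hyx'⟩)
    have h3 : (S.image c ∪ T.image c).card ≤ dichromaticOn r (S ∪ T) := by
      rw [← Finset.image_union, ← Finset.card_range (dichromaticOn r (S ∪ T))]
      exact Finset.card_le_card
        (Finset.image_subset_iff.2 fun v hv => Finset.mem_range.2 (hlt v hv))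
    rw [Finset.card_union_of_disjoint hdisj] at h3
    lia
  singleton x := by
    have hc : IsAcyclicColoring r {x} fun _ => 0 := fun i =>
      InducesAcyclic.of_rank (fun _ => 0) fun a ha b hb hab => by
        rw [Finset.mem_singleton.1 ha.1, Finset.mem_singleton.1 hb.1] at hab
        exact absurd hab (hirr x)
    simpa using hc.dichromaticOn_le
  pair x y hxy := by
    have key : ∀ x y, x ≠ y → ¬ r y x → IsAcyclicColoring r {x, y} fun _ => 0 := by
      intro x y hne hyx i
      refine InducesAcyclic.of_rank (fun v => if v = x then 0 else 1) fun a ha b hb hab => ?_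
      have ha' := ha.1
      have hb' := hb.1
      simp only [Finset.mem_insert, Finset.mem_singleton] at ha' hb'
      rcases ha' with rfl | rfl <;> rcases hb' with rfl | rfl
      · exact absurd hab (hirr _)
      · simp [hne.symm]
      · exact absurd hab hyx
      · exact absurd hab (hirr _)
    obtain ⟨hne, hnot⟩ := (hH x y).1 hxy
    have hc : IsAcyclicColoring r {x, y} fun _ => 0 := by
      by_cases hyx : r y x
      · rw [Finset.pair_comm]
        exact key y x hne.symm fun h => hnot ⟨h, hyx⟩
      · exact key x y hne hyx
    refine hc.dichromaticOn_le.trans (Finset.card_le_one.2 ?_)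
    simp

end dichromatic

theorem SimpleGraph.Connected.isUnsplit_univ {V : Type*} [Fintype V] [DecidableEq V]
    {H : SimpleGraph V} (hH : H.Connected) : IsUnsplit H Finset.univ := by
  rintro T - ⟨x, hx⟩ hsep
  refine Finset.eq_univ_of_forall fun y => ?_
  obtain ⟨p⟩ := hH.preconnected x y
  induction p with
  | nil => exact hx
  | cons hadj _ ih =>
    refine ih ?_
    by_contra hv
    exact (hsep _ hx _ (by simpa using hv)).2 hadj


/-- If the graph `G₂` (distinct `u, v` adjacent iff not both `r u v` and
`r v u`) is connected and `a(D - v) = a(D) - 1` for every vertex `v`, then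
`2 · a(D) ≤ n + 1`. -/
theorem stmt_10 {V : Type*} [Fintype V] [DecidableEq V]
    (r : V → V → Prop) (hirr : Irreflexive r)
    (G₂ : SimpleGraph V)
    (hG₂ : ∀ u v : V, G₂.Adj u v ↔ u ≠ v ∧ ¬ (r u v ∧ r v u))
    (hConn : G₂.Connected)
    (hCrit : ∀ v : V,
      dichromaticOn r (Finset.univ.erase v) = dichromaticOn r Finset.univ - 1) :
    2 * dichromaticOn r Finset.univ ≤ Fintype.card V + 1 := by
  have h := isChromaticFor_dichromaticOn hirr G₂ hG₂
  obtain ⟨v₀⟩ := hConn.nonempty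
  have hpos : 0 < dichromaticOn r Finset.univ := by
    obtain ⟨c, -, hlt⟩ := exists_isAcyclicColoring hirr (Finset.univ : Finset V)
    exact (Nat.zero_le _).trans_lt (hlt v₀ (Finset.mem_univ _))
  have hS : IsCritical (dichromaticOn r) Finset.univ := fun v _ => by
    rw [hCrit v]
    lia
  exact h.two_mul_le_of_isUnsplit hS hConn.isUnsplit_univ ⟨v₀, Finset.mem_univ _⟩
    fun U _ hU => h.exists_criticalPartition U hU
end
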